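/- There exists a constant c_n > 0, depending only on n, such that for any ℂ-convex domain D ⊆ ℂ^n containing no complex affine line one has κ_D(z;X)/4 ≤ B_D(z;X) ≤ 4c_n·γ_D(z;X) for all z ∈ D and all nonzero X ∈ ℂ^n. -/

import Mathlib

open Complex Metric Set MeasureTheory

noncomputable section

/-- `ℂ^n` with the Euclidean (Hermitian) structure. -/
abbrev Cn (n : ℕ) := EuclideanSpace ℂ (Fin n)

instance (n : ℕ) : MeasurableSpace (Cn n) := borel _
instance (n : ℕ) : BorelSpace (Cn n) := ⟨rfl⟩

/-- The complex affine line through `z` in direction `X`. -/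
def cline {n : ℕ} (z X : Cn n) : Set (Cn n) := {w | ∃ l : ℂ, w = z + l • X}

/-- A domain: a nonempty connected open set. -/
def IsDomain' {n : ℕ} (D : Set (Cn n)) : Prop := IsOpen D ∧ IsConnected D

/-- `D` is ℂ-convex: its intersection with every complex affine line is, when
nonempty, connected and simply connected. -/
def IsCConvex {n : ℕ} (D : Set (Cn n)) : Prop :=
  ∀ z X : Cn n, X ≠ 0 → (D ∩ cline z X).Nonempty →
    IsConnected (D ∩ cline z X) ∧ SimplyConnectedSpace ↥(D ∩ cline z X)

/-- The Carathéodory metric `γ_D(z;X)`. -/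
def caraMetric {n : ℕ} (D : Set (Cn n)) (z X : Cn n) : ℝ :=
  sSup {r : ℝ | ∃ f : Cn n → ℂ, DifferentiableOn ℂ f D ∧ MapsTo f D (ball (0:ℂ) 1) ∧
    f z = 0 ∧ r = ‖fderiv ℂ f z X‖}

/-- The Kobayashi metric `κ_D(z;X)`. -/
def kobMetric {n : ℕ} (D : Set (Cn n)) (z X : Cn n) : ℝ :=
  sInf {a : ℝ | 0 ≤ a ∧ ∃ φ : ℂ → Cn n, DifferentiableOn ℂ φ (ball (0:ℂ) 1) ∧
    MapsTo φ (ball (0:ℂ) 1) D ∧ φ 0 = z ∧ a • (fderiv ℂ φ 0 1) = X}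

/-- The distance `d_D(z,X)` from `z` to `∂D` in direction `X`. -/
def dirDist {n : ℕ} (D : Set (Cn n)) (z X : Cn n) : ℝ :=
  sSup {r : ℝ | 0 < r ∧ ∀ l : ℂ, ‖l‖ < r → z + l • X ∈ D}

/-- The Euclidean distance `d_D(z)` from `z` to `∂D`. -/
def bdist {n : ℕ} (D : Set (Cn n)) (z : Cn n) : ℝ := Metric.infDist z (frontier D)

/-- `L_a`: the set of vectors `X` such that a disc `{a + λX : |λ| < ε}` lies in `∂D`. -/
def La {n : ℕ} (D : Set (Cn n)) (a : Cn n) : Set (Cn n) :=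
  {X | ∃ ε > (0:ℝ), ∀ l : ℂ, ‖l‖ < ε → a + l • X ∈ frontier D}

/-- `D` contains no complex affine line. -/
def NoComplexLine {n : ℕ} (D : Set (Cn n)) : Prop :=
  ¬ ∃ z X : Cn n, X ≠ 0 ∧ cline z X ⊆ D

/-- The Bergman kernel `K_D(z)` (restricted to the diagonal). -/
def bergmanKernel {n : ℕ} (D : Set (Cn n)) (z : Cn n) : ℝ :=
  sSup {r : ℝ | ∃ f : Cn n → ℂ, DifferentiableOn ℂ f D ∧
    IntegrableOn (fun w => ‖f w‖ ^ 2) D ∧ (∫ w in D, ‖f w‖ ^ 2) ≤ 1 ∧ r = ‖f z‖ ^ 2}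

/-- `M_D(z;X)`. -/
def bergmanM {n : ℕ} (D : Set (Cn n)) (z X : Cn n) : ℝ :=
  sSup {r : ℝ | ∃ f : Cn n → ℂ, DifferentiableOn ℂ f D ∧
    IntegrableOn (fun w => ‖f w‖ ^ 2) D ∧ (∫ w in D, ‖f w‖ ^ 2) = 1 ∧
    f z = 0 ∧ r = ‖fderiv ℂ f z X‖}

/-- The Bergman metric `B_D(z;X) = M_D(z;X)/√K_D(z)`. -/
def bergmanMetric {n : ℕ} (D : Set (Cn n)) (z X : Cn n) : ℝ :=
  bergmanM D z X / Real.sqrt (bergmanKernel D z)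

/-- `G` is weakly linearly convex: through every boundary point there is a complex
affine hyperplane missing `G`. -/
def WeaklyLinConvex {n : ℕ} (G : Set (Cn n)) : Prop :=
  ∀ a ∈ frontier G, ∃ ℓ : Cn n →L[ℂ] ℂ, ℓ ≠ 0 ∧ ∀ z ∈ G, ℓ z ≠ ℓ a

/-- `d_{j,D}(z)` from the minimal-distance construction: the distance from `z` to the
boundary of the slice of `D` by the affine subspace `z + span{v_i : i ≥ j}`. -/
def sliceDist {n : ℕ} (D : Set (Cn n)) (z : Cn n) (v : Fin n → Cn n) (j : Fin n) : ℝ :=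
  sSup {r : ℝ | 0 < r ∧
    ∀ w ∈ Submodule.span ℂ (v '' {i | j ≤ i}), ‖w‖ < r → z + w ∈ D}

/-- The data `(v j)` is an admissible output of the minimal-distance construction at `z`:
the directions are orthonormal and each `v j` realizes the distance `d_{j,D}(z)` to the
boundary of the corresponding slice. -/
def MinimalBasis {n : ℕ} (D : Set (Cn n)) (z : Cn n) (v : Fin n → Cn n) : Prop :=
  Orthonormal ℂ v ∧ ∀ j : Fin n, z + (sliceDist D z v j) • v j ∉ D

open scoped Topology ComplexConjugate

/-- Every continuous nonvanishing function on `S` has a continuous logarithm on `S`. -/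
def HasContLog {α : Type*} [TopologicalSpace α] (S : Set α) : Prop :=
  ∀ f : α → ℂ, ContinuousOn f S → (∀ x ∈ S, f x ≠ 0) →
    ∃ L : α → ℂ, ContinuousOn L S ∧ ∀ x ∈ S, exp (L x) = f x

lemma IsPreconnected.eq_of_exp_eq {α : Type*} [TopologicalSpace α] {S : Set α}
    (hS : IsPreconnected S) {k : α → ℂ} (hk : ContinuousOn k S) {c : ℂ}
    (hc : ∀ x ∈ S, exp (k x) = c) {x y : α} (hx : x ∈ S) (hy : y ∈ S) : k x = k y := by
  have key : ∀ z ∈ S, ∃ n : ℤ, k z = k x + n * (2 * Real.pi * I) := fun z hz =>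
    exp_eq_exp_iff_exists_int.1 ((hc z hz).trans (hc x hx).symm)
  obtain ⟨n, hn⟩ := key y hy
  have hpi : (Real.pi : ℝ) ≠ 0 := Real.pi_ne_zero
  set g : α → ℝ := fun z => (k z - k x).im / (2 * Real.pi) with hg
  have hgc : ContinuousOn g S :=
    ((continuous_im.comp_continuousOn (hk.sub continuousOn_const))).div_const _
  have hgint : ∀ z ∈ S, ∃ m : ℤ, g z = m := by
    intro z hz
    obtain ⟨m, hm⟩ := key z hz
    refine ⟨m, ?_⟩
    simp only [hg, hm]
    simp
  have himg : (g '' S).OrdConnected := (hS.image g hgc).ordConnected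
  have hgx : g x = 0 := by simp [hg]
  have hgy : g y = n := by
    simp only [hg, hn]
    simp
  have hn0 : n = 0 := by
    by_contra hne
    rcases lt_or_gt_of_ne hne with h | h
    · have h1 : (-1/2 : ℝ) ∈ g '' S := by
        have h2 : (n : ℝ) ≤ -1 := by exact_mod_cast Int.le_sub_one_of_lt h
        exact himg.out ⟨y, hy, hgy⟩ ⟨x, hx, hgx⟩ ⟨by linarith, by norm_num⟩
      obtain ⟨z, hz, hz'⟩ := h1
      obtain ⟨m, hm⟩ := hgint z hz
      rw [hz'] at hm
      have : (2 * m : ℝ) = -1 := by linarith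
      have : (2 * m : ℤ) = -1 := by exact_mod_cast this
      omega
    · have h1 : (1/2 : ℝ) ∈ g '' S := by
        have h2 : (1 : ℝ) ≤ n := by exact_mod_cast h
        exact himg.out ⟨x, hx, hgx⟩ ⟨y, hy, hgy⟩ ⟨by norm_num, by linarith⟩
      obtain ⟨z, hz, hz'⟩ := h1
      obtain ⟨m, hm⟩ := hgint z hz
      rw [hz'] at hm
      have : (2 * m : ℝ) = 1 := by linarith
      have : (2 * m : ℤ) = 1 := by exact_mod_cast this
      omega
  rw [hn, hn0]; simp

lemma hasContLog_univ : HasContLog (univ : Set ℂ) := by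
  intro f hf h0
  have hs : IsSimplyConnected (univ : Set ℂ) := by
    have : SimplyConnectedSpace ℂ := inferInstance
    exact (Homeomorph.Set.univ ℂ).toHomotopyEquiv.simplyConnectedSpace
  obtain ⟨L, hL, hL'⟩ := exists_continuousOn_eqOn_exp_comp hs isOpen_univ hf
    (by rintro ⟨x, hx, h⟩; exact h0 x hx h)
  exact ⟨L, hL, fun x hx => hL' hx⟩

section FiberLog

variable {X : Type*} [TopologicalSpace X] {E : X → Set ℂ} {f : X × ℂ → ℂ} {L : X → ℂ → ℂ}

lemma exists_local_log (hE : IsOpen {p : X × ℂ | p.2 ∈ E p.1})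
    (hf : ContinuousOn f {p : X × ℂ | p.2 ∈ E p.1})
    (hL : ∀ x, ContinuousOn (L x) (E x)) (hexp : ∀ x, ∀ t ∈ E x, exp (L x t) = f (x, t))
    {x₀ : X} {q : ℂ} (hq : q ∈ E x₀) :
    ∃ V : Set X, ∃ B : Set ℂ, ∃ l : X × ℂ → ℂ, IsOpen V ∧ IsOpen B ∧ x₀ ∈ V ∧ q ∈ B ∧
      (∀ x ∈ V, B ⊆ E x) ∧ ContinuousOn l (V ×ˢ B) ∧
      ∀ x ∈ V, ∀ t ∈ B, ∀ s ∈ B, L x t - L x s = l (x, t) - l (x, s) := by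
  have hfq : f (x₀, q) ≠ 0 := by rw [← hexp x₀ q hq]; exact exp_ne_zero _
  have hfc : ContinuousAt f (x₀, q) := hf.continuousAt (hE.mem_nhds hq)
  have h1 : ∀ᶠ p in 𝓝 (x₀, q), p.2 ∈ E p.1 ∧ f p / f (x₀, q) ∈ slitPlane := by
    refine Filter.Eventually.and
      (hE.mem_nhds (show (x₀, q) ∈ {p : X × ℂ | p.2 ∈ E p.1} from hq)) ?_
    have : ContinuousAt (fun p => f p / f (x₀, q)) (x₀, q) := hfc.div_const _
    apply this.eventually
    apply isOpen_slitPlane.mem_nhds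
    simp [div_self hfq]
  obtain ⟨V, hV, W, hW, hVW⟩ := Filter.eventually_prod_iff.1 (nhds_prod_eq (x := x₀) (y := q) ▸ h1)
  obtain ⟨V', hV', hV'o, hxV'⟩ := mem_nhds_iff.1 hV
  obtain ⟨r, hr, hrW⟩ := Metric.mem_nhds_iff.1 hW
  have hprop : ∀ x ∈ V', ∀ t ∈ ball q r, t ∈ E x ∧ f (x, t) / f (x₀, q) ∈ slitPlane :=
    fun x hx t ht => hVW (hV' hx) (hrW ht)
  refine ⟨V', ball q r, fun p => log (f p / f (x₀, q)), hV'o, isOpen_ball, hxV',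
    mem_ball_self hr, fun x hx t ht => (hprop x hx t ht).1, ?_, ?_⟩
  · apply ContinuousOn.clog
    · apply ContinuousOn.div_const
      exact hf.mono fun p hp => (hprop p.1 hp.1 p.2 hp.2).1
    · exact fun p hp => (hprop p.1 hp.1 p.2 hp.2).2
  · intro x hx t ht s hs
    have hpre : IsPreconnected (ball q r) := (convex_ball q r).isPreconnected
    have := hpre.eq_of_exp_eq (k := fun u => L x u - log (f (x, u) / f (x₀, q)))
      (c := f (x₀, q)) ?_ ?_ ht hs
    · linear_combination this
    · apply ContinuousOn.sub
      · exact (hL x).mono fun u hu => (hprop x hx u hu).1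
      · apply ContinuousOn.clog
        · apply ContinuousOn.div_const
          refine hf.comp (f := fun u => (x, u)) (by fun_prop) ?_
          exact fun u hu => (hprop x hx u hu).1
        · exact fun u hu => (hprop x hx u hu).2
    · intro u hu
      have h2 := hprop x hx u hu
      have hfu : f (x, u) ≠ 0 := by rw [← hexp x u h2.1]; exact exp_ne_zero _
      rw [exp_sub, hexp x u h2.1, exp_log (div_ne_zero hfu hfq)]
      field_simp

/-- Increments of fibrewise logarithms along connected fibres are continuous. -/
lemma continuousAt_log_sub (hE : IsOpen {p : X × ℂ | p.2 ∈ E p.1})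
    (hconn : ∀ x, IsPreconnected (E x))
    (hf : ContinuousOn f {p : X × ℂ | p.2 ∈ E p.1})
    (hL : ∀ x, ContinuousOn (L x) (E x)) (hexp : ∀ x, ∀ t ∈ E x, exp (L x t) = f (x, t))
    {x₀ : X} {p q : ℂ} (hp : p ∈ E x₀) (hq : q ∈ E x₀) :
    ContinuousAt (fun y : X × ℂ => L y.1 y.2 - L y.1 p) (x₀, q) := by
  have hC : ContinuousAt (fun x => L x q - L x p) x₀ := by
    refine (hconn x₀).induction₂ (fun q p => ContinuousAt (fun x => L x q - L x p) x₀)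
      ?_ ?_ ?_ hq hp
    · intro q hq
      obtain ⟨V, B, l, hV, hB, hxV, hqB, hVB, hl, hlL⟩ := exists_local_log hE hf hL hexp hq
      filter_upwards [mem_nhdsWithin_of_mem_nhds (hB.mem_nhds hqB)] with t ht
      have : (fun x => L x q - L x t) =ᶠ[𝓝 x₀] fun x => l (x, q) - l (x, t) := by
        filter_upwards [hV.mem_nhds hxV] with x hx using hlL x hx q hqB t ht
      refine ContinuousAt.congr ?_ this.symm
      have h1 : ∀ t ∈ B, ContinuousAt (fun x => l (x, t)) x₀ := fun t ht =>
        ContinuousAt.comp (f := fun x => (x, t))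
          (hl.continuousAt ((hV.prod hB).mem_nhds ⟨hxV, ht⟩)) (by fun_prop)
      exact (h1 q hqB).sub (h1 t ht)
    · intro a b c _ _ _ hab hbc
      refine (hab.add hbc).congr (Filter.Eventually.of_forall fun x => ?_)
      simp
    · intro a b _ _ hab
      refine hab.neg.congr (Filter.Eventually.of_forall fun x => ?_)
      simp
  obtain ⟨V, B, l, hV, hB, hxV, hqB, hVB, hl, hlL⟩ := exists_local_log hE hf hL hexp hq
  have hcl : ∀ t ∈ B, ContinuousAt l (x₀, t) := fun t ht =>
    hl.continuousAt ((hV.prod hB).mem_nhds ⟨hxV, ht⟩)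
  have : (fun y : X × ℂ => L y.1 y.2 - L y.1 p) =ᶠ[𝓝 (x₀, q)]
      fun y => (l y - l (y.1, q)) + (L y.1 q - L y.1 p) := by
    filter_upwards [(hV.prod hB).mem_nhds (⟨hxV, hqB⟩ : (x₀, q) ∈ V ×ˢ B)] with y hy
    rw [← hlL y.1 hy.1 y.2 hy.2 q hqB]
    ring
  refine ContinuousAt.congr ?_ this.symm
  refine ((hcl q hqB).sub ?_).add ?_
  · exact ContinuousAt.comp (f := fun y : X × ℂ => (y.1, q)) (x := (x₀, q))
      (hcl q hqB) (by fun_prop)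
  · exact ContinuousAt.comp (f := fun y : X × ℂ => y.1) (x := (x₀, q)) hC (by fun_prop)

end FiberLog

/-- A family of connected planar open sets with continuous logarithms over the plane has
continuous logarithms on its total space. -/
lemma hasContLog_totalSpace {E : ℂ → Set ℂ} (hE : IsOpen {p : ℂ × ℂ | p.2 ∈ E p.1})
    (hconn : ∀ x, IsPreconnected (E x)) (hne : ∀ x, (E x).Nonempty)
    (hlog : ∀ x, HasContLog (E x)) : HasContLog {p : ℂ × ℂ | p.2 ∈ E p.1} := by
  intro f hf hf0
  have hsec : ∀ x, ContinuousOn (fun t => f (x, t)) (E x) := fun x =>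
    hf.comp (f := fun t => (x, t)) (by fun_prop) fun t ht => ht
  choose L hL hexp using fun x => hlog x (fun t => f (x, t)) (hsec x) fun t ht => hf0 (x, t) ht
  choose τ hτ using hne
  have hslice : ∀ t : ℂ, IsOpen {x | t ∈ E x} := fun t =>
    hE.preimage (f := fun x : ℂ => (x, t)) (by fun_prop)
  obtain ⟨ρ, hρ⟩ := PartitionOfUnity.exists_isSubordinate (X := ℂ) isClosed_univ
    (fun i : ℂ => {x | τ i ∈ E x}) (fun i => hslice _) fun x _ => mem_iUnion.2 ⟨x, hτ x⟩
  set c : ℂ → ℂ := fun x => ∑ᶠ i, ρ i x • L x (τ i) with hc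
  have hψ : ContinuousOn (fun p : ℂ × ℂ => L p.1 p.2 - c p.1) {p : ℂ × ℂ | p.2 ∈ E p.1} := by
    rintro ⟨x₀, t₀⟩ ht₀
    apply ContinuousAt.continuousWithinAt
    change t₀ ∈ E x₀ at ht₀
    have h1 := continuousAt_log_sub hE hconn hf hL hexp ht₀ ht₀
    have h2 : ContinuousAt (fun x => L x t₀ - c x) x₀ := by
      obtain ⟨J, hJ⟩ := ρ.exists_finset_nhds x₀
      have : (fun x => L x t₀ - c x) =ᶠ[𝓝 x₀]
          fun x => ∑ i ∈ J, ρ i x • (L x t₀ - L x (τ i)) := by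
        filter_upwards [hJ] with x hx
        have : c x = ∑ i ∈ J, ρ i x • L x (τ i) := by
          rw [hc]
          apply finsum_eq_sum_of_support_subset
          exact (Function.support_smul_subset_left _ _).trans hx.2
        rw [this]
        simp only [smul_sub, Finset.sum_sub_distrib]
        rw [← Finset.sum_smul, hx.1, one_smul]
      refine ContinuousAt.congr ?_ this.symm
      refine tendsto_finsetSum _ fun i _ => ?_
      by_cases hi : x₀ ∈ tsupport (ρ i)
      · refine (ρ i).continuous.continuousAt.smul ?_
        have h3 := continuousAt_log_sub hE hconn hf hL hexp (hρ i hi) ht₀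
        exact ContinuousAt.comp (f := fun x => (x, t₀)) h3 (by fun_prop)
      · have h0 : (fun x => ρ i x • (L x t₀ - L x (τ i))) =ᶠ[𝓝 x₀] fun _ => 0 := by
          filter_upwards [(isClosed_tsupport _).isOpen_compl.mem_nhds hi] with x hx
          rw [image_eq_zero_of_notMem_tsupport hx, zero_smul]
        exact (continuousAt_const.congr h0.symm)
    have h3 : ContinuousAt (fun p : ℂ × ℂ => L p.1 t₀ - c p.1) (x₀, t₀) :=
      ContinuousAt.comp (f := fun p : ℂ × ℂ => p.1) (x := (x₀, t₀)) h2 (by fun_prop)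
    refine (h1.add h3).congr (Filter.Eventually.of_forall fun x => ?_)
    simp
  have hcc : Continuous fun x => exp (c x) := by
    rw [continuous_iff_continuousAt]
    intro x₀
    have hmem : (x₀, τ x₀) ∈ {p : ℂ × ℂ | p.2 ∈ E p.1} := hτ x₀
    have h1 : ContinuousAt (fun p : ℂ × ℂ => f p / exp (L p.1 p.2 - c p.1)) (x₀, τ x₀) :=
      (hf.continuousAt (hE.mem_nhds hmem)).div (hψ.continuousAt (hE.mem_nhds hmem)).cexp
        (exp_ne_zero _)
    have h2 : ContinuousAt (fun x => f (x, τ x₀) / exp (L x (τ x₀) - c x)) x₀ :=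
      ContinuousAt.comp (f := fun x => (x, τ x₀)) h1 (by fun_prop)
    refine h2.congr ?_
    filter_upwards [(hslice (τ x₀)).mem_nhds (hτ x₀)] with x hx
    rw [← hexp x _ hx, ← exp_sub]
    simp
  obtain ⟨k, hk, hk'⟩ := hasContLog_univ _ hcc.continuousOn fun x _ => exp_ne_zero _
  refine ⟨fun p => (L p.1 p.2 - c p.1) + k p.1, hψ.add ?_, fun p hp => ?_⟩
  · exact (hk.comp (f := fun p : ℂ × ℂ => p.1) (by fun_prop) fun p _ => mem_univ _)
  · rw [exp_add, hk' _ (mem_univ _), ← exp_add, ← hexp p.1 p.2 hp]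
    simp

/-- Every complex line meets `D` in a connected set admitting continuous logarithms. -/
def LineConvex {V : Type*} [AddCommGroup V] [Module ℂ V] (D : Set V) : Prop :=
  ∀ z X : V, IsPreconnected {t : ℂ | z + t • X ∈ D} ∧ HasContLog {t : ℂ | z + t • X ∈ D}

namespace LineConvex

variable {V : Type*} [NormedAddCommGroup V] [NormedSpace ℂ V] {D : Set V}

lemma isPreconnected (h : LineConvex D) : IsPreconnected D := by
  refine isPreconnected_of_forall_pair fun x hx y hy => ?_
  refine ⟨(fun t : ℂ => x + t • (y - x)) '' {t : ℂ | x + t • (y - x) ∈ D}, ?_, ?_, ?_, ?_⟩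
  · rintro _ ⟨t, ht, rfl⟩
    exact ht
  · exact ⟨0, by simpa using hx, by simp⟩
  · exact ⟨1, by simpa using hy, by simp⟩
  · exact (h x (y - x)).1.image _ (by fun_prop)

lemma hasContLog (h : LineConvex D) (hD : IsOpen D) : HasContLog D := by
  intro F hF hF0
  rcases D.eq_empty_or_nonempty with rfl | ⟨p, hp⟩
  · exact ⟨0, by simp, by simp⟩
  set φ : V × ℂ → V := fun y => p + y.2 • (y.1 - p) with hφ
  have hφc : Continuous φ := by fun_prop
  set E : V → Set ℂ := fun z => {t : ℂ | p + t • (z - p) ∈ D} with hEdef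
  have hE : IsOpen {y : V × ℂ | y.2 ∈ E y.1} := hD.preimage hφc
  have hf : ContinuousOn (fun y => F (φ y)) {y : V × ℂ | y.2 ∈ E y.1} :=
    hF.comp hφc.continuousOn fun y hy => hy
  choose L hL hexp using fun z => (h p (z - p)).2 (fun t => F (φ (z, t)))
    (hF.comp (by fun_prop) fun t ht => ht) fun t ht => hF0 _ ht
  have hconn : ∀ z, IsPreconnected (E z) := fun z => (h p (z - p)).1
  have h0 : ∀ z, (0 : ℂ) ∈ E z := fun z => by simpa [hEdef] using hp
  have h1 : ∀ z ∈ D, (1 : ℂ) ∈ E z := fun z hz => by simpa [hEdef] using hz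
  refine ⟨fun z => L z 1 - L z 0 + log (F p), ?_, ?_⟩
  · intro z hz
    apply ContinuousAt.continuousWithinAt
    have := continuousAt_log_sub hE hconn hf hL hexp (h0 z) (h1 z hz)
    exact (ContinuousAt.comp (f := fun x => (x, (1 : ℂ))) this (by fun_prop)).add
      continuousAt_const
  · intro z hz
    rw [exp_add, exp_sub, hexp z 1 (h1 z hz), hexp z 0 (h0 z), exp_log (hF0 p hp)]
    have := hF0 p hp
    simp only [hφ, one_smul, zero_smul, add_zero, add_sub_cancel]
    field_simp

lemma preimage_affine (h : LineConvex D) {W : Type*} [AddCommGroup W] [Module ℂ W]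
    (u : V) (A : W →ₗ[ℂ] V) : LineConvex {w | u + A w ∈ D} := by
  intro z X
  have : {t : ℂ | z + t • X ∈ {w | u + A w ∈ D}} = {t : ℂ | (u + A z) + t • A X ∈ D} := by
    ext t
    simp [add_assoc]
  rw [this]
  exact h _ _

lemma isPreconnected_image_fst {K : Type*} [NormedAddCommGroup K] [NormedSpace ℂ K]
    {E : Set (ℂ × K)} (h : LineConvex E) : IsPreconnected (Prod.fst '' E) :=
  h.isPreconnected.image _ continuous_fst.continuousOn

lemma hasContLog_image_fst {K : Type*} [NormedAddCommGroup K] [NormedSpace ℂ K]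
    {E : Set (ℂ × K)} (h : LineConvex E) (hE : IsOpen E) : HasContLog (Prod.fst '' E) := by
  intro F hF hF0
  obtain ⟨G, hG, hG'⟩ := h.hasContLog hE (fun y => F y.1)
    (hF.comp continuousOn_fst fun y hy => mem_image_of_mem _ hy)
    fun y hy => hF0 _ (mem_image_of_mem _ hy)
  have hfib : ∀ t, IsPreconnected {m | (t, m) ∈ E} := fun t => by
    have := h.preimage_affine (t, (0 : K)) (LinearMap.inr ℂ ℂ K)
    simpa using this.isPreconnected
  have hconst : ∀ t m m', (t, m) ∈ E → (t, m') ∈ E → G (t, m) = G (t, m') :=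
    fun t m m' hm hm' => (hfib t).eq_of_exp_eq (k := fun m => G (t, m)) (c := F t)
      (hG.comp (by fun_prop) fun m hm => hm) (fun m hm => hG' _ hm) hm hm'
  have hsec : ∀ t, ∃ m, t ∈ Prod.fst '' E → (t, m) ∈ E := by
    intro t
    by_cases ht : t ∈ Prod.fst '' E
    · obtain ⟨⟨t', m⟩, hm, rfl⟩ := ht
      exact ⟨m, fun _ => hm⟩
    · exact ⟨0, fun h => absurd h ht⟩
  choose m hm using hsec
  refine ⟨fun t => G (t, m t), ?_, fun t ht => hG' _ (hm t ht)⟩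
  intro t ht
  apply ContinuousAt.continuousWithinAt
  have h1 : ContinuousAt (fun s => G (s, m t)) t :=
    ContinuousAt.comp (f := fun s => (s, m t)) (hG.continuousAt (hE.mem_nhds (hm t ht)))
      (by fun_prop)
  refine h1.congr ?_
  have h2 : IsOpen {s | (s, m t) ∈ E} := hE.preimage (f := fun s => (s, m t)) (by fun_prop)
  filter_upwards [h2.mem_nhds (hm t ht)] with s hs
  exact hconst s _ _ hs (hm s ⟨_, hs, rfl⟩)

/-- Shadows of `D` along a subspace are again connected with continuous logarithms. -/
lemma shadow (h : LineConvex D) (hD : IsOpen D) (M : Submodule ℂ V) (u v : V) :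
    IsPreconnected {t : ℂ | ∃ m ∈ M, u + t • v + m ∈ D} ∧
    HasContLog {t : ℂ | ∃ m ∈ M, u + t • v + m ∈ D} := by
  set A : ℂ × M →L[ℂ] V :=
    (ContinuousLinearMap.toSpanSingleton ℂ v).coprod M.subtypeL with hA
  have hE := h.preimage_affine u A.toLinearMap
  have hEo : IsOpen {y : ℂ × M | u + A y ∈ D} := hD.preimage (by fun_prop)
  have key : {t : ℂ | ∃ m ∈ M, u + t • v + m ∈ D} = Prod.fst '' {y : ℂ × M | u + A y ∈ D} := by
    ext t
    constructor
    · rintro ⟨m, hm, h⟩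
      refine ⟨(t, ⟨m, hm⟩), ?_, rfl⟩
      simpa [hA, add_assoc] using h
    · rintro ⟨⟨t, m⟩, h, rfl⟩
      exact ⟨m, m.2, by simpa [hA, add_assoc] using h⟩
  rw [key]
  exact ⟨isPreconnected_image_fst hE, hasContLog_image_fst hE hEo⟩

end LineConvex

lemma not_exists_log_compl_zero {l : ℂ → ℂ} (hl : ContinuousOn l {0}ᶜ)
    (hexp : ∀ z ≠ 0, exp (l z) = z) : False := by
  have hpre : IsPreconnected (univ : Set ℝ) := isPreconnected_univ
  have := hpre.eq_of_exp_eq (k := fun θ : ℝ => l (exp (θ * I)) - θ * I) (c := 1) ?_ ?_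
    (mem_univ 0) (mem_univ (2 * Real.pi))
  · have h2 : exp ((2 * Real.pi : ℝ) * I) = 1 := by
      push_cast
      exact exp_two_pi_mul_I
    simp only [h2] at this
    simp only [ofReal_zero, zero_mul, exp_zero, sub_zero] at this
    have h3 : (((2 * Real.pi : ℝ) : ℂ)) * I = 0 := by linear_combination this
    simp [Real.pi_ne_zero] at h3
  · refine ContinuousOn.sub (hl.comp (by fun_prop) fun θ _ => exp_ne_zero _) (by fun_prop)
  · intro θ _
    rw [exp_sub, hexp _ (exp_ne_zero _), div_self (exp_ne_zero _)]

/-- Two-dimensional case of linear convexity: a line through the origin misses `D`. -/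
lemma LineConvex.exists_line_disjoint {D : Set (ℂ × ℂ)} (h : LineConvex D) (hD : IsOpen D)
    (h0 : (0 : ℂ × ℂ) ∉ D) : ∃ v : ℂ × ℂ, v ≠ 0 ∧ ∀ t : ℂ, t • v ∉ D := by
  by_contra! hcon
  have hlines : ∀ γ : ℂ → ℂ × ℂ, Continuous γ → (∀ ζ, γ ζ ≠ 0) →
      ∃ Λ : ℂ × ℂ → ℂ, ContinuousOn Λ {p : ℂ × ℂ | p.2 • γ p.1 ∈ D} ∧
        ∀ ζ t : ℂ, t • γ ζ ∈ D → exp (Λ (ζ, t)) = t := by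
    intro γ hγ hγ0
    have hx : ∀ ζ, IsPreconnected {t : ℂ | t • γ ζ ∈ D} ∧ HasContLog {t : ℂ | t • γ ζ ∈ D} :=
      fun ζ => by simpa using h 0 (γ ζ)
    have hEo : IsOpen {p : ℂ × ℂ | p.2 • γ p.1 ∈ D} := hD.preimage (by fun_prop)
    obtain ⟨Λ, hΛ, hΛ'⟩ := hasContLog_totalSpace (E := fun ζ => {t : ℂ | t • γ ζ ∈ D}) hEo
      (fun ζ => (hx ζ).1) (fun ζ => hcon _ (hγ0 ζ)) (fun ζ => (hx ζ).2) Prod.snd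
      continuousOn_snd (by
        rintro ⟨ζ, t⟩ ht rfl
        simp only [mem_ofPred_eq, zero_smul] at ht
        exact h0 ht)
    exact ⟨Λ, hΛ, fun ζ t ht => hΛ' (ζ, t) ht⟩
  obtain ⟨Λ₁, hΛ₁, hexp₁⟩ := hlines (fun ζ => (1, ζ)) (by fun_prop) fun ζ h => by
    simp at h
  obtain ⟨Λ₂, hΛ₂, hexp₂⟩ := hlines (fun ζ => (ζ, 1)) (by fun_prop) fun ζ h => by
    simp at h
  have hE₁ : IsOpen {p : ℂ × ℂ | p.2 • ((1 : ℂ), p.1) ∈ D} := hD.preimage (by fun_prop)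
  have hE₂ : IsOpen {p : ℂ × ℂ | p.2 • (p.1, (1 : ℂ)) ∈ D} := hD.preimage (by fun_prop)
  have hne : ∀ ζ : ℂ, ∃ t : ℂ, t • ((1 : ℂ), ζ) ∈ D := fun ζ => hcon _ fun h => by
    simp at h
  choose τ hτ using hne
  have hswap : ∀ ζ : ℂ, ζ ≠ 0 → ∀ t : ℂ, t • ((1 : ℂ), ζ) ∈ D → (ζ * t) • (ζ⁻¹, (1 : ℂ)) ∈ D := by
    intro ζ hζ t ht
    convert ht using 1
    simp only [Prod.smul_mk, smul_eq_mul, mul_one, Prod.mk.injEq]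
    constructor
    · field_simp
    · ring
  refine not_exists_log_compl_zero (l := fun ζ => Λ₂ (ζ⁻¹, ζ * τ ζ) - Λ₁ (ζ, τ ζ)) ?_ ?_
  · intro ζ hζ
    apply ContinuousAt.continuousWithinAt
    have hζ' : ζ ≠ 0 := hζ
    have h1 : ContinuousAt (fun s => Λ₂ (s⁻¹, s * τ ζ) - Λ₁ (s, τ ζ)) ζ := by
      refine ContinuousAt.sub ?_ ?_
      · exact ContinuousAt.comp (f := fun s : ℂ => (s⁻¹, s * τ ζ))
          (hΛ₂.continuousAt (hE₂.mem_nhds (hswap ζ hζ' _ (hτ ζ)))) (by fun_prop (disch := exact hζ'))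
      · exact ContinuousAt.comp (f := fun s : ℂ => (s, τ ζ))
          (hΛ₁.continuousAt (hE₁.mem_nhds (hτ ζ))) (by fun_prop)
    refine h1.congr ?_
    have h2 : IsOpen {s : ℂ | τ ζ • ((1 : ℂ), s) ∈ D} := hD.preimage (by fun_prop)
    filter_upwards [h2.mem_nhds (hτ ζ), isOpen_compl_singleton.mem_nhds hζ] with s hs hs0
    have hpre : IsPreconnected {t : ℂ | t • ((1 : ℂ), s) ∈ D} := by
      simpa using (h 0 ((1 : ℂ), s)).1
    refine hpre.eq_of_exp_eq (k := fun t => Λ₂ (s⁻¹, s * t) - Λ₁ (s, t)) (c := s) ?_ ?_ hs (hτ s)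
    · refine ContinuousOn.sub ?_ ?_
      · exact hΛ₂.comp (by fun_prop) fun t ht => hswap s hs0 t ht
      · exact hΛ₁.comp (by fun_prop) fun t ht => ht
    · intro t ht
      rw [exp_sub, hexp₁ s t ht, hexp₂ _ _ (hswap s hs0 t ht)]
      have : t ≠ 0 := by
        rintro rfl
        simp only [mem_ofPred_eq, zero_smul] at ht
        exact h0 ht
      field_simp
  · intro ζ hζ
    rw [exp_sub, hexp₁ ζ _ (hτ ζ), hexp₂ _ _ (hswap ζ hζ _ (hτ ζ))]
    have : τ ζ ≠ 0 := by
      intro h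
      have := hτ ζ
      rw [h, zero_smul] at this
      exact h0 this
    field_simp

lemma LineConvex.exists_dual_ne_zero {V : Type*} [NormedAddCommGroup V] [NormedSpace ℂ V]
    [FiniteDimensional ℂ V] {D : Set V} (h : LineConvex D) (hD : IsOpen D) (h0 : (0 : V) ∉ D)
    {z : V} (hz : z ∈ D) : ∃ l : V →ₗ[ℂ] ℂ, ∀ w ∈ D, l w ≠ 0 := by
  obtain ⟨M, hM⟩ := exists_maximal_of_wellFoundedGT
    (fun M : Submodule ℂ V => ∀ m ∈ M, m ∉ D) ⟨⊥, by simpa using h0⟩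
  have htop : M ⊔ Submodule.span ℂ {z} = ⊤ := by
    by_contra hne
    obtain ⟨x, -, hx⟩ := SetLike.exists_of_lt (lt_top_iff_ne_top.2 hne)
    set D' : Set (ℂ × ℂ) := {p | ∃ m ∈ M, p.1 • z + p.2 • x + m ∈ D} with hD'
    have hD'o : IsOpen D' := by
      have : D' = ⋃ m ∈ M, {p : ℂ × ℂ | p.1 • z + p.2 • x + m ∈ D} := by
        ext p
        simp [hD']
      rw [this]
      exact isOpen_biUnion fun m _ => hD.preimage (by fun_prop)
    have hD'c : LineConvex D' := by
      intro p q
      have : {t : ℂ | p + t • q ∈ D'} =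
          {t : ℂ | ∃ m ∈ M, (p.1 • z + p.2 • x) + t • (q.1 • z + q.2 • x) + m ∈ D} := by
        ext t
        simp only [hD', mem_ofPred_eq, Prod.fst_add, Prod.snd_add, Prod.smul_fst, Prod.smul_snd]
        refine exists_congr fun m => and_congr_right fun _ => ?_
        have : (p.1 + t • q.1) • z + (p.2 + t • q.2) • x + m =
            p.1 • z + p.2 • x + t • (q.1 • z + q.2 • x) + m := by
          simp only [smul_eq_mul]
          module
        rw [this]
      rw [this]
      exact h.shadow hD M _ _
    obtain ⟨v, hv, hvD⟩ := hD'c.exists_line_disjoint hD'o (by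
      rintro ⟨m, hm, hmD⟩
      exact hM.1 m hm (by simpa using hmD))
    set y := v.1 • z + v.2 • x with hy
    have hyM : y ∉ M := by
      intro hyM
      by_cases hv2 : v.2 = 0
      · have hv1 : v.1 ≠ 0 := fun h => hv (Prod.ext h hv2)
        have : z ∈ M := by
          have h3 : v.1⁻¹ • y = z := by
            rw [hy, hv2, zero_smul, add_zero, smul_smul, inv_mul_cancel₀ hv1, one_smul]
          exact h3 ▸ M.smul_mem _ hyM
        exact hM.1 z this hz
      · apply hx
        have h3 : x = v.2⁻¹ • y + (-(v.2⁻¹ * v.1)) • z := by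
          rw [hy, smul_add, smul_smul, smul_smul, inv_mul_cancel₀ hv2]
          module
        rw [h3]
        exact Submodule.add_mem_sup (M.smul_mem _ hyM)
          (Submodule.smul_mem _ _ (Submodule.mem_span_singleton_self z))
    have hbig : ∀ m ∈ M ⊔ Submodule.span ℂ {y}, m ∉ D := by
      intro w hw hwD
      obtain ⟨m, hm, w', hw', rfl⟩ := Submodule.mem_sup.1 hw
      obtain ⟨t, rfl⟩ := Submodule.mem_span_singleton.1 hw'
      refine hvD t ⟨m, hm, ?_⟩
      convert hwD using 1
      rw [hy]
      simp only [Prod.smul_fst, Prod.smul_snd, smul_eq_mul]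
      module
    have := hM.2 hbig le_sup_left
    exact hyM (this (Submodule.mem_sup_right (Submodule.mem_span_singleton_self y)))
  have hzM : z ∉ M := fun h => hM.1 z h hz
  obtain ⟨l, hl, hMl⟩ := Submodule.exists_le_ker_of_notMem hzM
  refine ⟨l, fun w hw hlw => ?_⟩
  have hwt : w ∈ M ⊔ Submodule.span ℂ {z} := htop ▸ Submodule.mem_top
  obtain ⟨m, hm, w', hw', rfl⟩ := Submodule.mem_sup.1 hwt
  obtain ⟨t, rfl⟩ := Submodule.mem_span_singleton.1 hw'
  have hlm : l m = 0 := hMl hm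
  rw [map_add, hlm, map_smul, zero_add, smul_eq_mul, mul_eq_zero] at hlw
  rcases hlw with rfl | h
  · exact hM.1 m hm (by simpa using hw)
  · exact hl h

/-- Points outside `D` are separated from `D` by complex hyperplanes. -/
lemma LineConvex.exists_separating {V : Type*} [NormedAddCommGroup V] [NormedSpace ℂ V]
    [FiniteDimensional ℂ V] {D : Set V} (h : LineConvex D) (hD : IsOpen D) {b z : V}
    (hb : b ∉ D) (hz : z ∈ D) :
    ∃ l : V →ₗ[ℂ] ℂ, l (b - z) = 1 ∧ ∀ w ∈ D, l (w - z) ≠ 1 := by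
  obtain ⟨l, hl⟩ := (h.preimage_affine b LinearMap.id).exists_dual_ne_zero
    (hD.preimage (by fun_prop)) (by simpa using hb) (z := z - b) (by simpa using hz)
  have hlz : l (b - z) ≠ 0 := by
    have := hl (z - b) (by simpa using hz)
    rwa [← neg_sub, map_neg, neg_ne_zero] at this
  refine ⟨(l (b - z))⁻¹ • l, inv_mul_cancel₀ hlz, fun w hw h1 => ?_⟩
  apply hl (w - b) (by simpa using hw)
  rw [LinearMap.smul_apply, smul_eq_mul, inv_mul_eq_one₀ hlz] at h1
  rw [show w - b = (w - z) - (b - z) by abel, map_sub, ← h1, sub_self]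

/-- Images of `D` under linear functionals are connected with continuous logarithms. -/
lemma LineConvex.image_dual {V : Type*} [NormedAddCommGroup V] [NormedSpace ℂ V]
    {D : Set V} (h : LineConvex D) (hD : IsOpen D) {l : V →ₗ[ℂ] ℂ} {v : V} (hv : l v = 1) :
    IsPreconnected (l '' D) ∧ HasContLog (l '' D) := by
  have : l '' D = {t : ℂ | ∃ m ∈ LinearMap.ker l, 0 + t • v + m ∈ D} := by
    ext t
    constructor
    · rintro ⟨w, hw, rfl⟩
      exact ⟨w - l w • v, by simp [hv], by simpa using hw⟩
    · rintro ⟨m, hm, hmD⟩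
      refine ⟨_, hmD, ?_⟩
      have : l m = 0 := hm
      simp [hv, this]
  rw [this]
  exact h.shadow hD _ _ _

lemma IsCConvex.lineConvex {n : ℕ} {D : Set (Cn n)} (hD : IsOpen D) (h : IsCConvex D) :
    LineConvex D := by
  intro z X
  by_cases hX : X = 0
  · subst hX
    by_cases hz : z ∈ D
    · have : {t : ℂ | z + t • (0 : Cn n) ∈ D} = univ := by
        ext; simp [hz]
      rw [this]
      exact ⟨isPreconnected_univ, hasContLog_univ⟩
    · have : {t : ℂ | z + t • (0 : Cn n) ∈ D} = ∅ := by
        ext; simp [hz]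
      rw [this]
      exact ⟨isPreconnected_empty, fun f _ _ => ⟨0, by simp, by simp⟩⟩
  set φ : ℂ → Cn n := fun t => z + t • X with hφ
  set S : Set ℂ := {t : ℂ | z + t • X ∈ D} with hS
  rcases S.eq_empty_or_nonempty with hSe | ⟨t₀, ht₀⟩
  · rw [hSe]
    exact ⟨isPreconnected_empty, fun f _ _ => ⟨0, by simp, by simp⟩⟩
  have hemb : Topology.IsEmbedding φ := by
    have h1 : Topology.IsClosedEmbedding fun t : ℂ => t • X := isClosedEmbedding_smul_left hX
    exact ((Homeomorph.addLeft z).isClosedEmbedding.comp h1).isEmbedding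
  have himg : φ '' S = D ∩ cline z X := by
    ext w
    constructor
    · rintro ⟨t, ht, rfl⟩
      exact ⟨ht, t, rfl⟩
    · rintro ⟨hw, t, rfl⟩
      exact ⟨t, hw, rfl⟩
  obtain ⟨h1, h2⟩ := h z X hX ⟨φ t₀, himg ▸ mem_image_of_mem _ ht₀⟩
  rw [← himg] at h1 h2
  have hsc : IsSimplyConnected S := hemb.isSimplyConnected_image.1 h2
  refine ⟨hemb.isInducing.isPreconnected_image.1 h1.isPreconnected, ?_⟩
  intro f hf hf0
  have hSo : IsOpen S := hD.preimage (by fun_prop)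
  obtain ⟨L, hL, hL'⟩ := exists_continuousOn_eqOn_exp_comp hsc hSo hf
    (by rintro ⟨x, hx, h⟩; exact hf0 x hx h)
  exact ⟨L, hL, fun x hx => hL' hx⟩

lemma differentiableOn_of_exp_eq {G : Set ℂ} (hG : IsOpen G) {F L : ℂ → ℂ}
    (hF : DifferentiableOn ℂ F G) (hL : ContinuousOn L G) (hexp : ∀ x ∈ G, exp (L x) = F x) :
    DifferentiableOn ℂ L G := by
  intro w hw
  apply DifferentiableAt.differentiableWithinAt
  have hFw : F w ≠ 0 := by rw [← hexp w hw]; exact exp_ne_zero _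
  have hLw : ContinuousAt L w := hL.continuousAt (hG.mem_nhds hw)
  have him : ∀ᶠ x in 𝓝 w, (L x - L w).im ∈ Ioo (-Real.pi) Real.pi := by
    have : ContinuousAt (fun x => (L x - L w).im) w :=
      continuous_im.continuousAt.comp (hLw.sub continuousAt_const)
    apply this.eventually
    apply isOpen_Ioo.mem_nhds
    simp [Real.pi_pos]
  have heq : L =ᶠ[𝓝 w] fun x => L w + log (F x / F w) := by
    filter_upwards [him, hG.mem_nhds hw] with x hx hxG
    rw [← hexp x hxG, ← hexp w hw, ← exp_sub, log_exp hx.1 hx.2.le]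
    ring
  refine DifferentiableAt.congr_of_eventuallyEq ?_ heq
  refine DifferentiableAt.const_add _ (DifferentiableAt.clog ?_ ?_)
  · exact (hF.differentiableAt (hG.mem_nhds hw)).div_const _
  · simp [div_self hFw]

lemma HasContLog.exists_sqrt {G : Set ℂ} (hlog : HasContLog G) (hG : IsOpen G) {F : ℂ → ℂ}
    (hF : DifferentiableOn ℂ F G) (hF0 : ∀ z ∈ G, F z ≠ 0) :
    ∃ h : ℂ → ℂ, DifferentiableOn ℂ h G ∧ ∀ z ∈ G, h z ^ 2 = F z := by
  obtain ⟨L, hL, hexp⟩ := hlog F hF.continuousOn hF0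
  have hLd := differentiableOn_of_exp_eq hG hF hL hexp
  refine ⟨fun z => exp (L z / 2), (hLd.div_const 2).cexp, fun z hz => ?_⟩
  rw [← exp_nat_mul, ← hexp z hz]
  congr 1
  push_cast
  ring

lemma enorm_mul_le_lintegral_circle {F : ℂ → ℂ} (hF : DiffContOnCl ℂ F (ball 0 1)) :
    ‖F 0‖ₑ * ENNReal.ofReal (2 * Real.pi) ≤
      ∫⁻ θ in Ioc (0 : ℝ) (2 * Real.pi), ‖F (exp (θ * I))‖ₑ := by
  have hpi : 0 < 2 * Real.pi := by positivity
  have h1 := (DiffContOnCl.circleAverage (f := F) (c := 0) (R := 1) (by simpa using hF))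
  rw [Real.circleAverage_def, intervalIntegral.integral_of_le hpi.le] at h1
  have h2 : F 0 * (2 * Real.pi : ℝ) = ∫ θ in Ioc (0 : ℝ) (2 * Real.pi), F (exp (θ * I)) := by
    rw [← h1, mul_comm, ← real_smul, smul_smul, mul_inv_cancel₀ hpi.ne', one_smul]
    simp [circleMap]
  calc ‖F 0‖ₑ * ENNReal.ofReal (2 * Real.pi) = ‖F 0 * (2 * Real.pi : ℝ)‖ₑ := by
        rw [enorm_mul]
        congr 1
        rw [← ofReal_norm, norm_real, Real.norm_of_nonneg hpi.le]
    _ ≤ _ := by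
        rw [h2]
        exact enorm_integral_le_lintegral_enorm _

/-- Mean value inequality over a rotation invariant set. -/
lemma setLIntegral_le_of_circle_mean {E : Type*} [NormedAddCommGroup E] [NormedSpace ℂ E]
    [MeasurableSpace E] [BorelSpace E] [SecondCountableTopology E] {μ : Measure E} [SFinite μ]
    (hμ : ∀ c : ℂ, ‖c‖ = 1 → MeasurePreserving (fun w : E => c • w) μ μ)
    {S : Set E} (hS : MeasurableSet S) (hrot : ∀ c : ℂ, ‖c‖ = 1 → ∀ w ∈ S, c • w ∈ S)
    {u m : E → ENNReal} (hu : ContinuousOn u S)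
    (hm : ∀ w ∈ S, m w * ENNReal.ofReal (2 * Real.pi) ≤
      ∫⁻ θ in Ioc (0 : ℝ) (2 * Real.pi), u (exp (θ * I) • w)) :
    ∫⁻ w in S, m w ∂μ ≤ ∫⁻ w in S, u w ∂μ := by
  have hpi : 0 < 2 * Real.pi := by positivity
  have hne : ENNReal.ofReal (2 * Real.pi) ≠ 0 := by simpa using Real.pi_pos
  have hnt : ENNReal.ofReal (2 * Real.pi) ≠ ⊤ := ENNReal.ofReal_ne_top
  have hnorm : ∀ θ : ℝ, ‖exp (θ * I)‖ = 1 := fun θ => norm_exp_ofReal_mul_I θ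
  have hinv : ∀ θ : ℝ, ∫⁻ w in S, u (exp (θ * I) • w) ∂μ = ∫⁻ w in S, u w ∂μ := by
    intro θ
    have hpre : (fun w : E => exp (θ * I) • w) ⁻¹' S = S := by
      ext w
      refine ⟨fun hw => ?_, fun hw => hrot _ (hnorm θ) w hw⟩
      have := hrot (exp (θ * I))⁻¹ (by rw [norm_inv, hnorm, inv_one]) _ hw
      rwa [inv_smul_smul₀ (exp_ne_zero _)] at this
    have hemb : MeasurableEmbedding (fun w : E => exp (θ * I) • w) :=
      (Homeomorph.smulOfNeZero (exp (θ * I)) (exp_ne_zero _)).measurableEmbedding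
    have := (hμ _ (hnorm θ)).setLIntegral_comp_preimage_emb hemb u S
    rwa [hpre] at this
  rw [← ENNReal.mul_le_mul_iff_left hne hnt, ← lintegral_mul_const' _ _ hnt]
  calc ∫⁻ w in S, m w * ENNReal.ofReal (2 * Real.pi) ∂μ
      ≤ ∫⁻ w in S, (∫⁻ θ in Ioc (0 : ℝ) (2 * Real.pi), u (exp (θ * I) • w)) ∂μ :=
        setLIntegral_mono' hS hm
    _ = ∫⁻ θ in Ioc (0 : ℝ) (2 * Real.pi), (∫⁻ w in S, u (exp (θ * I) • w) ∂μ) := by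
        apply lintegral_lintegral_swap
        rw [Measure.prod_restrict]
        apply ContinuousOn.aemeasurable _ (hS.prod measurableSet_Ioc)
        exact hu.comp (f := fun p : E × ℝ => exp (p.2 * I) • p.1) (by fun_prop)
          fun p hp => hrot _ (hnorm _) _ hp.1
    _ = (∫⁻ w in S, u w ∂μ) * ENNReal.ofReal (2 * Real.pi) := by
        simp_rw [hinv]
        rw [lintegral_const]
        simp [Real.volume_Ioc]

lemma measurePreserving_smul_complex {c : ℂ} (hc : ‖c‖ = 1) :
    MeasurePreserving (fun w : ℂ => c • w) volume volume := by
  have h0 : c ≠ 0 := by rintro rfl; simp at hc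
  let e : ℂ ≃ₗᵢ[ℝ] ℂ :=
    { (LinearEquiv.smulOfNeZero ℂ ℂ c h0).restrictScalars ℝ with
      norm_map' := fun w => by
        change ‖c • w‖ = ‖w‖
        rw [norm_smul, hc, one_mul] }
  exact e.measurePreserving

lemma setLIntegral_annulus {a b : ℝ} (ha : 0 < a) (hab : a < b) :
    ∫⁻ z in {z : ℂ | ‖z‖ ∈ Ioo a b}, ENNReal.ofReal (‖z‖ ^ 2)⁻¹ =
      ENNReal.ofReal (2 * Real.pi * Real.log (b / a)) := by
  have hS : MeasurableSet {z : ℂ | ‖z‖ ∈ Ioo a b} := measurable_norm measurableSet_Ioo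
  rw [← lintegral_indicator hS, ← Complex.lintegral_comp_polarCoord_symm]
  have h1 : ∀ p ∈ polarCoord.target, ENNReal.ofReal p.1 •
      ({z : ℂ | ‖z‖ ∈ Ioo a b}.indicator (fun z => ENNReal.ofReal (‖z‖ ^ 2)⁻¹)
        (Complex.polarCoord.symm p)) =
      (Ioo a b).indicator (fun r => ENNReal.ofReal r⁻¹) p.1 := by
    rintro ⟨r, θ⟩ ⟨hr, hθ⟩
    have hr : 0 < r := hr
    have hn : ‖Complex.polarCoord.symm (r, θ)‖ = r := by
      rw [Complex.norm_polarCoord_symm, abs_of_pos hr]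
    by_cases hrab : r ∈ Ioo a b
    · rw [indicator_of_mem (show _ ∈ {z : ℂ | ‖z‖ ∈ Ioo a b} by rw [mem_ofPred_eq, hn]; exact hrab), indicator_of_mem hrab, hn, smul_eq_mul,
        ← ENNReal.ofReal_mul hr.le]
      congr 1
      field_simp
    · rw [indicator_of_notMem (show _ ∉ {z : ℂ | ‖z‖ ∈ Ioo a b} by rw [mem_ofPred_eq, hn]; exact hrab), indicator_of_notMem hrab, smul_zero]
  rw [setLIntegral_congr_fun polarCoord.open_target.measurableSet h1]
  change ∫⁻ p in (Ioi (0 : ℝ)) ×ˢ (Ioo (-Real.pi) Real.pi), _ = _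
  rw [Measure.volume_eq_prod, ← Measure.prod_restrict, lintegral_prod _ (by
    apply Measurable.aemeasurable
    apply Measurable.indicator (by fun_prop) measurableSet_Ioo |>.comp measurable_fst)]
  simp only [lintegral_const, Measure.restrict_apply MeasurableSet.univ, univ_inter, Real.volume_Ioo]
  rw [lintegral_mul_const' _ _ ENNReal.ofReal_ne_top, lintegral_indicator measurableSet_Ioo,
    Measure.restrict_restrict measurableSet_Ioo,
    inter_eq_left.2 (fun r hr => mem_Ioi.2 (ha.trans hr.1)),
    restrict_Ioo_eq_restrict_Ioc, ← ofReal_integral_eq_lintegral_ofReal,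
    ← intervalIntegral.integral_of_le hab.le, integral_inv_of_pos ha (ha.trans hab),
    ← ENNReal.ofReal_mul]
  · congr 1
    ring
  · exact Real.log_nonneg (by rw [le_div_iff₀ ha]; linarith)
  · have : IntervalIntegrable (fun r : ℝ => r⁻¹) volume a b := by
      apply intervalIntegral.intervalIntegrable_inv
      · intro x hx
        rw [uIcc_of_le hab.le] at hx
        exact (ha.trans_le hx.1).ne'
      · exact continuousOn_id
    exact (intervalIntegrable_iff_integrableOn_Ioc_of_le hab.le).1 this
  · filter_upwards [ae_restrict_mem measurableSet_Ioc] with r hr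
    exact inv_nonneg.2 (ha.trans hr.1).le

lemma setLIntegral_image_holomorphic {S G : Set ℂ} (hG : IsOpen G) (hS : MeasurableSet S)
    (hSG : S ⊆ G) {f : ℂ → ℂ} (hf : DifferentiableOn ℂ f G) (hinj : InjOn f S)
    (g : ℂ → ENNReal) :
    ∫⁻ w in f '' S, g w = ∫⁻ z in S, ENNReal.ofReal (‖deriv f z‖ ^ 2) * g (f z) := by
  have hd : ∀ z ∈ S, HasFDerivWithinAt f
      ((ContinuousLinearMap.toSpanSingleton ℂ (deriv f z)).restrictScalars ℝ) S z := fun z hz =>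
    ((hf.differentiableAt (hG.mem_nhds (hSG hz))).hasDerivAt.hasFDerivAt.restrictScalars
      ℝ).hasFDerivWithinAt
  rw [lintegral_image_eq_lintegral_abs_det_fderiv_mul volume hS hd hinj]
  refine setLIntegral_congr_fun hS fun z _ => ?_
  have : ((ContinuousLinearMap.toSpanSingleton ℂ (deriv f z)).restrictScalars ℝ).det =
      ‖deriv f z‖ ^ 2 := by
    rw [ContinuousLinearMap.det]
    have h2 : (((ContinuousLinearMap.toSpanSingleton ℂ (deriv f z)).restrictScalars ℝ :
        ℂ →L[ℝ] ℂ) : ℂ →ₗ[ℝ] ℂ) =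
        ((ContinuousLinearMap.toSpanSingleton ℂ (deriv f z) : ℂ →L[ℂ] ℂ) :
          ℂ →ₗ[ℂ] ℂ).restrictScalars ℝ := rfl
    rw [h2, LinearMap.det_restrictScalars, Algebra.norm_complex_apply, normSq_eq_norm_sq]
    congr 2
    rw [LinearMap.det_ring]
    simp
  rw [this, abs_of_nonneg (by positivity)]

lemma setLIntegral_annulus_le_logArea {P : ℂ → ℂ} {ρ δ r : ℝ} (hrρ : r < ρ) (hδ : 0 < δ)
    (hP : DifferentiableOn ℂ P (ball 0 ρ))
    (hd0 : ∀ z ∈ ball (0 : ℂ) ρ, dslope P 0 z ≠ 0) (hP0 : P 0 = 0) :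
    ∫⁻ z in {z : ℂ | ‖z‖ ∈ Ioo δ r}, ENNReal.ofReal (‖z‖ ^ 2)⁻¹ ≤
      ∫⁻ z in {z : ℂ | ‖z‖ ∈ Ioo δ r},
        ENNReal.ofReal (‖deriv P z‖ ^ 2) * ENNReal.ofReal (‖P z‖ ^ 2)⁻¹ := by
  have hS : MeasurableSet {z : ℂ | ‖z‖ ∈ Ioo δ r} := measurable_norm measurableSet_Ioo
  rcases lt_or_ge δ r with hδr | hδr
  swap
  · have : {z : ℂ | ‖z‖ ∈ Ioo δ r} = ∅ := by
      rw [Ioo_eq_empty hδr.not_gt]; simp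
    rw [this]
    simp
  have hρ : 0 < ρ := hδ.trans (hδr.trans hrρ)
  have hd : DifferentiableOn ℂ (dslope P 0) (ball 0 ρ) :=
    (differentiableOn_dslope (isOpen_ball.mem_nhds (mem_ball_self hρ))).2 hP
  have hPd : ∀ z, P z = z * dslope P 0 z := fun z => by
    have := sub_smul_dslope P 0 z
    simpa [hP0] using this.symm
  set k : ℂ → ℂ := fun z => (deriv P z / dslope P 0 z) ^ 2 with hk
  have hkd : DifferentiableOn ℂ k (ball 0 ρ) := ((hP.deriv isOpen_ball).div hd hd0).pow 2
  have hk0 : k 0 = 1 := by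
    have := hd0 0 (mem_ball_self hρ)
    simp only [dslope_same] at this
    simp [hk, dslope_same, div_self this]
  have hu : ∫⁻ z in {z : ℂ | ‖z‖ ∈ Ioo δ r},
        ENNReal.ofReal (‖deriv P z‖ ^ 2) * ENNReal.ofReal (‖P z‖ ^ 2)⁻¹ =
      ∫⁻ z in {z : ℂ | ‖z‖ ∈ Ioo δ r}, ENNReal.ofReal ((‖z‖ ^ 2)⁻¹ * ‖k z‖) := by
    refine setLIntegral_congr_fun hS fun z hz => ?_
    rw [← ENNReal.ofReal_mul (by positivity)]
    congr 1
    rw [hPd z, hk, norm_mul, norm_pow, norm_div]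
    have : ‖z‖ ≠ 0 := (hδ.trans hz.1).ne'
    field_simp
  rw [hu]
  refine setLIntegral_le_of_circle_mean (fun c hc => measurePreserving_smul_complex hc) hS
    (fun c hc w hw => by
      rw [mem_ofPred_eq, norm_smul, hc, one_mul]; exact hw) ?_ ?_
  · apply ENNReal.continuous_ofReal.comp_continuousOn
    apply ContinuousOn.mul
    · apply ContinuousOn.inv₀ (by fun_prop)
      intro z hz
      have : ‖z‖ ≠ 0 := (hδ.trans hz.1).ne'
      positivity
    · exact (hkd.continuousOn.mono fun z hz => by
        simpa using hz.2.trans hrρ).norm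
  · intro w hw
    have hF : DiffContOnCl ℂ (fun t => k (t * w)) (ball 0 1) := by
      apply DifferentiableOn.diffContOnCl
      rw [closure_ball _ one_ne_zero]
      refine hkd.comp (by fun_prop) fun t ht => ?_
      rw [mem_ball_zero_iff, norm_mul]
      have : ‖t‖ ≤ 1 := by simpa using ht
      calc ‖t‖ * ‖w‖ ≤ 1 * ‖w‖ := by gcongr
        _ < ρ := by rw [one_mul]; exact hw.2.trans hrρ
    have h1 := enorm_mul_le_lintegral_circle hF
    rw [zero_mul, hk0, enorm_one, one_mul] at h1
    calc _ ≤ ENNReal.ofReal (‖w‖ ^ 2)⁻¹ *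
          ∫⁻ θ in Ioc (0 : ℝ) (2 * Real.pi), ‖k (exp (θ * I) * w)‖ₑ := by gcongr
      _ = _ := by
        rw [← lintegral_const_mul' _ _ ENNReal.ofReal_ne_top]
        refine lintegral_congr fun θ => ?_
        rw [ENNReal.ofReal_mul (by positivity), ofReal_norm, norm_smul, norm_exp_ofReal_mul_I,
          one_mul, smul_eq_mul]

/-- Gronwall-type area inequality for functions omitting mutually inverse values. -/
lemma norm_deriv_mul_le_one_of_mul_ne_one {P : ℂ → ℂ} {ρ : ℝ} (hρ : 0 < ρ)
    (hP : DifferentiableOn ℂ P (ball 0 ρ)) (hinj : InjOn P (ball 0 ρ)) (hP0 : P 0 = 0)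
    (hmul : ∀ z ∈ ball (0 : ℂ) ρ, ∀ w ∈ ball (0 : ℂ) ρ, P z * P w ≠ 1) :
    ‖deriv P 0‖ * ρ ≤ 1 := by
  by_contra! hcon
  have hD0 : 0 < ‖deriv P 0‖ := by
    by_contra! h
    have : ‖deriv P 0‖ = 0 := le_antisymm h (norm_nonneg _)
    rw [this, zero_mul] at hcon
    linarith
  obtain ⟨r, hr1, hrρ⟩ := exists_between (show ‖deriv P 0‖⁻¹ < ρ by
    rw [inv_lt_iff_one_lt_mul₀' hD0]; exact hcon)
  have hr : 0 < r := (inv_pos.2 hD0).trans hr1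
  obtain ⟨c, hc1, hcD⟩ := exists_between (inv_lt_of_inv_lt₀ hD0 hr1)
  have hc : 0 < c := (inv_pos.2 hr).trans hc1
  have hcr : 1 < c * r := by rwa [inv_lt_iff_one_lt_mul₀ hr] at hc1
  have hd : DifferentiableOn ℂ (dslope P 0) (ball 0 ρ) :=
    (differentiableOn_dslope (isOpen_ball.mem_nhds (mem_ball_self hρ))).2 hP
  have hPd : ∀ z, P z = z * dslope P 0 z := fun z => by
    have := sub_smul_dslope P 0 z
    simpa [hP0] using this.symm
  have hPne : ∀ z ∈ ball (0 : ℂ) ρ, z ≠ 0 → P z ≠ 0 := fun z hz h0 h =>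
    h0 (hinj hz (mem_ball_self hρ) (h.trans hP0.symm))
  have hd0 : ∀ z ∈ ball (0 : ℂ) ρ, dslope P 0 z ≠ 0 := by
    intro z hz
    by_cases h0 : z = 0
    · rw [h0, dslope_same]
      exact norm_pos_iff.1 hD0
    · intro h
      exact hPne z hz h0 (by rw [hPd, h, mul_zero])
  have hsub : closedBall (0 : ℂ) r ⊆ ball 0 ρ := closedBall_subset_ball hrρ
  obtain ⟨zm, hzm, hm⟩ := (isCompact_closedBall (0 : ℂ) r).exists_isMinOn
    ⟨0, mem_closedBall_self hr.le⟩ ((hd.continuousOn.mono hsub).norm)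
  set m := ‖dslope P 0 zm‖ with hmdef
  have hm0 : 0 < m := norm_pos_iff.2 (hd0 _ (hsub hzm))
  obtain ⟨M, hM⟩ := (isCompact_closedBall (0 : ℂ) r).exists_bound_of_continuousOn
    (hP.continuousOn.mono hsub)
  have hnear : ∀ᶠ z in 𝓝 (0 : ℂ), c < ‖dslope P 0 z‖ := by
    have h1 : ContinuousAt (fun z => ‖dslope P 0 z‖) 0 :=
      (hd.continuousOn.continuousAt (isOpen_ball.mem_nhds (mem_ball_self hρ))).norm
    exact h1.eventually (lt_mem_nhds (by simpa [dslope_same] using hcD))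
  obtain ⟨s, hs, hsd⟩ := Metric.eventually_nhds_iff.1 hnear
  have hev : ∀ᶠ δ in 𝓝[>] (0 : ℝ), δ < r ∧ δ * c < s * m ∧ δ * c * (|M| + 1) < 1 := by
    refine Filter.Eventually.and ?_ (Filter.Eventually.and ?_ ?_)
    · exact nhdsWithin_le_nhds (eventually_lt_nhds hr)
    · apply nhdsWithin_le_nhds
      have : ContinuousAt (fun δ : ℝ => δ * c) 0 := by fun_prop
      exact this.eventually (gt_mem_nhds (by simp; positivity))
    · apply nhdsWithin_le_nhds
      have : ContinuousAt (fun δ : ℝ => δ * c * (|M| + 1)) 0 := by fun_prop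
      exact this.eventually (gt_mem_nhds (by simp))
  obtain ⟨δ, ⟨hδr, hδs, hδM⟩, hδ⟩ := (hev.and self_mem_nhdsWithin).exists
  have hδ : 0 < δ := hδ
  set ε := δ * c with hε
  have hε0 : 0 < ε := mul_pos hδ hc
  have hε1 : ε < 1 := by
    have : 0 ≤ |M| := abs_nonneg M
    nlinarith
  set A := {z : ℂ | ‖z‖ ∈ Ioo δ r} with hA
  set W := {z : ℂ | ‖z‖ ∈ Ioo ε ε⁻¹} with hW
  have hAm : MeasurableSet A := measurable_norm measurableSet_Ioo
  have hAball : A ⊆ ball 0 ρ \ {0} := by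
    intro z hz
    refine ⟨by simpa using hz.2.trans hrρ, ?_⟩
    exact norm_pos_iff.1 (hδ.trans hz.1)
  have hPA : ∀ z ∈ A, ‖P z‖ ∈ Ioo ε ε⁻¹ := by
    intro z hz
    constructor
    · rw [hPd, norm_mul]
      by_cases hzs : ‖z‖ < s
      · have := hsd (y := z) (by simpa using hzs)
        have h2 := hz.1
        calc ε = δ * c := rfl
          _ < ‖z‖ * ‖dslope P 0 z‖ := by gcongr
      · push Not at hzs
        have : m ≤ ‖dslope P 0 z‖ := hm (by simpa using hz.2.le)
        calc ε < s * m := hδs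
          _ ≤ _ := by gcongr
    · have h1 := hM z (by simpa using hz.2.le)
      rw [lt_inv_comm₀ (norm_pos_iff.2 (hPne z (hAball hz).1 (hAball hz).2)) hε0]
      have h3 : ‖P z‖ < |M| + 1 := by linarith [le_abs_self M]
      have h4 : 0 < ‖P z‖ := norm_pos_iff.2 (hPne z (hAball hz).1 (hAball hz).2)
      rw [lt_inv_comm₀ hε0 h4, ← one_div, lt_div_iff₀ hε0]
      nlinarith
  have hinjA : InjOn P A := hinj.mono fun z hz => (hAball hz).1
  have hinjQ : InjOn (fun z => (P z)⁻¹) A := fun x hx y hy h => hinjA hx hy (inv_injective h)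
  have hGo : IsOpen (ball (0 : ℂ) ρ \ {0}) := isOpen_ball.sdiff isClosed_singleton
  have hPG : DifferentiableOn ℂ P (ball (0 : ℂ) ρ \ {0}) := hP.mono sdiff_subset
  have hQG : DifferentiableOn ℂ (fun z => (P z)⁻¹) (ball (0 : ℂ) ρ \ {0}) :=
    hPG.inv fun z hz => hPne z hz.1 hz.2
  have hI1 := setLIntegral_image_holomorphic hGo hAm hAball hPG hinjA
    fun z => ENNReal.ofReal (‖z‖ ^ 2)⁻¹
  have hI2 := setLIntegral_image_holomorphic hGo hAm hAball hQG hinjQ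
    fun z => ENNReal.ofReal (‖z‖ ^ 2)⁻¹
  have hI12 : ∫⁻ z in A, ENNReal.ofReal (‖deriv (fun z => (P z)⁻¹) z‖ ^ 2) *
        ENNReal.ofReal (‖(P z)⁻¹‖ ^ 2)⁻¹ =
      ∫⁻ z in A, ENNReal.ofReal (‖deriv P z‖ ^ 2) * ENNReal.ofReal (‖P z‖ ^ 2)⁻¹ := by
    refine setLIntegral_congr_fun hAm fun z hz => ?_
    have hz' := hAball hz
    have hne := hPne z hz'.1 hz'.2
    have hder : deriv (fun z => (P z)⁻¹) z = -deriv P z / P z ^ 2 :=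
      ((hP.differentiableAt (isOpen_ball.mem_nhds hz'.1)).hasDerivAt.inv hne).deriv
    rw [hder, ← ENNReal.ofReal_mul (by positivity), ← ENNReal.ofReal_mul (by positivity)]
    congr 1
    have : ‖P z‖ ≠ 0 := norm_ne_zero_iff.2 hne
    rw [norm_div, norm_neg, norm_pow, norm_inv]
    field_simp
  have hdisj : Disjoint (P '' A) ((fun z => (P z)⁻¹) '' A) := by
    rw [Set.disjoint_left]
    rintro _ ⟨z, hz, rfl⟩ ⟨w, hw, h⟩
    apply hmul z (hAball hz).1 w (hAball hw).1
    dsimp only at h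
    rw [← h, inv_mul_cancel₀ (hPne w (hAball hw).1 (hAball hw).2)]
  have hQm : MeasurableSet ((fun z => (P z)⁻¹) '' A) :=
    hAm.image_of_continuousOn_injOn (hQG.continuousOn.mono hAball) hinjQ
  have hsubW : P '' A ∪ (fun z => (P z)⁻¹) '' A ⊆ W := by
    rintro _ (⟨z, hz, rfl⟩ | ⟨z, hz, rfl⟩)
    · exact hPA z hz
    · have := hPA z hz
      have hpos : 0 < ‖P z‖ := hε0.trans this.1
      rw [hW, mem_ofPred_eq, norm_inv]
      exact ⟨(lt_inv_comm₀ hε0 hpos).2 this.2, (inv_lt_inv₀ hpos hε0).2 this.1⟩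
  have hlow := setLIntegral_annulus_le_logArea hrρ hδ hP hd0 hP0
  have hmain := lintegral_mono_set (μ := volume) (f := fun z : ℂ => ENNReal.ofReal (‖z‖ ^ 2)⁻¹)
    hsubW
  rw [lintegral_union hQm hdisj, hI1, hI2, hI12,
    setLIntegral_annulus hε0 (hε1.trans (one_lt_inv₀ hε0 |>.2 hε1))] at hmain
  have hfin := (add_le_add hlow hlow).trans hmain
  rw [setLIntegral_annulus hδ hδr, ← ENNReal.ofReal_add, ENNReal.ofReal_le_ofReal_iff] at hfin
  · have hlog : Real.log (ε⁻¹ / ε) = 2 * Real.log ε⁻¹ := by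
      rw [div_eq_mul_inv, Real.log_mul (inv_ne_zero hε0.ne') (inv_ne_zero hε0.ne')]
      ring
    have hlt : Real.log ε⁻¹ < Real.log (r / δ) := by
      apply Real.log_lt_log (inv_pos.2 hε0)
      rw [lt_div_iff₀ hδ, inv_mul_lt_iff₀ hε0, hε]
      nlinarith
    rw [hlog] at hfin
    nlinarith [Real.pi_pos]
  · have : 0 ≤ Real.log (ε⁻¹ / ε) := Real.log_nonneg (by
      rw [le_div_iff₀ hε0, one_mul]
      exact (hε1.trans (one_lt_inv₀ hε0 |>.2 hε1)).le)
    positivity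
  all_goals
    have : 0 ≤ Real.log (r / δ) := Real.log_nonneg (by rw [le_div_iff₀ hδ]; linarith)
    positivity

/-- Bounded univalent functions on `G`, with nonvanishing derivative. -/
structure IsUnivalent (G : Set ℂ) (f : ℂ → ℂ) : Prop where
  diff : DifferentiableOn ℂ f G
  inj : InjOn f G
  maps : MapsTo f G (ball 0 1)
  deriv_ne : ∀ z ∈ G, deriv f z ≠ 0

lemma one_sub_conj_mul_ne_zero {b w : ℂ} (hb : ‖b‖ < 1) (hw : ‖w‖ < 1) : 1 - conj b * w ≠ 0 := by
  intro h
  have h1 : conj b * w = 1 := (sub_eq_zero.1 h).symm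
  have h2 : ‖b‖ * ‖w‖ = 1 := by rw [← RCLike.norm_conj b, ← norm_mul, h1, norm_one]
  nlinarith [norm_nonneg b, norm_nonneg w]

lemma norm_moebius_lt_one {b w : ℂ} (hb : ‖b‖ < 1) (hw : ‖w‖ < 1) :
    ‖(w - b) / (1 - conj b * w)‖ < 1 := by
  have h0 := norm_pos_iff.2 (one_sub_conj_mul_ne_zero hb hw)
  rw [norm_div, div_lt_one h0, ← sq_lt_sq₀ (norm_nonneg _) h0.le]
  have hb2 : ‖b‖ ^ 2 < 1 := by nlinarith [norm_nonneg b]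
  have hw2 : ‖w‖ ^ 2 < 1 := by nlinarith [norm_nonneg w]
  simp only [← normSq_eq_norm_sq, normSq_apply] at hb2 hw2 ⊢
  simp
  nlinarith [mul_pos (sub_pos.2 hb2) (sub_pos.2 hw2)]

lemma hasDerivAt_moebius {b w : ℂ} (hb : ‖b‖ < 1) (hw : ‖w‖ < 1) :
    HasDerivAt (fun w => (w - b) / (1 - conj b * w))
      ((1 - (‖b‖ : ℂ) ^ 2) / (1 - conj b * w) ^ 2) w := by
  have h0 := one_sub_conj_mul_ne_zero hb hw
  have h1 : HasDerivAt (fun w : ℂ => w - b) 1 w := (hasDerivAt_id w).sub_const b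
  have h2 : HasDerivAt (fun w : ℂ => 1 - conj b * w) (-(conj b * 1)) w :=
    ((hasDerivAt_id w).const_mul (conj b)).const_sub 1
  refine (h1.fun_div h2 h0).congr_deriv ?_
  congr 1
  rw [← mul_conj' b]
  ring

lemma one_sub_norm_sq_ne_zero {b : ℂ} (hb : ‖b‖ < 1) : (1 - (‖b‖ : ℂ) ^ 2) ≠ 0 := by
  have : (1 - ‖b‖ ^ 2 : ℝ) ≠ 0 := by nlinarith [norm_nonneg b]
  exact_mod_cast this

namespace IsUnivalent

variable {G : Set ℂ} {f : ℂ → ℂ}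

lemma hasDerivAt_moebius_comp (hG : IsOpen G) (hf : IsUnivalent G f) {b z : ℂ} (hb : ‖b‖ < 1)
    (hz : z ∈ G) : HasDerivAt (fun z => (f z - b) / (1 - conj b * f z))
      ((1 - (‖b‖ : ℂ) ^ 2) / (1 - conj b * f z) ^ 2 * deriv f z) z :=
  (hasDerivAt_moebius hb (by simpa using hf.maps hz)).comp (h₂ := fun w => (w - b) / (1 - conj b * w)) z
    (hf.diff.differentiableAt (hG.mem_nhds hz)).hasDerivAt

lemma moebius (hG : IsOpen G) (hf : IsUnivalent G f) {b : ℂ} (hb : ‖b‖ < 1) :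
    IsUnivalent G fun z => (f z - b) / (1 - conj b * f z) where
  diff z hz := (hf.hasDerivAt_moebius_comp hG hb hz).differentiableAt.differentiableWithinAt
  inj z hz w hw h := by
    apply hf.inj hz hw
    have h1 := one_sub_conj_mul_ne_zero hb (by simpa using hf.maps hz)
    have h2 := one_sub_conj_mul_ne_zero hb (by simpa using hf.maps hw)
    have h3 := one_sub_norm_sq_ne_zero hb
    dsimp only at h
    rw [div_eq_div_iff h1 h2] at h
    apply mul_left_cancel₀ h3
    rw [← mul_conj' b]
    linear_combination h
  maps z hz := by
    rw [mem_ball_zero_iff]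
    exact norm_moebius_lt_one hb (by simpa using hf.maps hz)
  deriv_ne z hz := by
    rw [(hf.hasDerivAt_moebius_comp hG hb hz).deriv]
    have h1 := one_sub_conj_mul_ne_zero hb (by simpa using hf.maps hz)
    exact mul_ne_zero (div_ne_zero (one_sub_norm_sq_ne_zero hb) (pow_ne_zero _ h1))
      (hf.deriv_ne z hz)

lemma exists_sqrt (hG : IsOpen G) (hlog : HasContLog G) (hf : IsUnivalent G f)
    (hf0 : ∀ z ∈ G, f z ≠ 0) : ∃ g, IsUnivalent G g ∧ ∀ z ∈ G, g z ^ 2 = f z ∧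
      2 * g z * deriv g z = deriv f z := by
  obtain ⟨g, hg, hgf⟩ := hlog.exists_sqrt hG hf.diff hf0
  have hder : ∀ z ∈ G, 2 * g z * deriv g z = deriv f z := by
    intro z hz
    have h1 : HasDerivAt (fun z => g z ^ 2) (2 * g z * deriv g z) z := by
      exact ((hg.differentiableAt (hG.mem_nhds hz)).hasDerivAt.fun_pow 2).congr_deriv (by simp)
    have h2 : (fun z => g z ^ 2) =ᶠ[𝓝 z] f := by
      filter_upwards [hG.mem_nhds hz] with w hw using hgf w hw
    rw [← h1.deriv, h2.deriv_eq]
  refine ⟨g, ⟨hg, fun z hz w hw h => hf.inj hz hw ?_, fun z hz => ?_, fun z hz h => ?_⟩,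
    fun z hz => ⟨hgf z hz, hder z hz⟩⟩
  · rw [← hgf z hz, ← hgf w hw, h]
  · have h1 := hf.maps hz
    rw [mem_ball_zero_iff, ← hgf z hz, norm_pow] at h1
    rw [mem_ball_zero_iff]
    exact (sq_lt_one_iff₀ (norm_nonneg _)).1 h1
  · apply hf.deriv_ne z hz
    rw [← hder z hz, h, mul_zero]

/-- Koebe's square root improvement step. -/
lemma exists_larger_deriv (hG : IsOpen G) (hlog : HasContLog G) (hf : IsUnivalent G f) {a b : ℂ}
    (ha : a ∈ G) (hfa : f a = 0) {σ : ℝ} (hσ1 : σ < 1) (hσ0 : 0 < σ) (hb : ‖b‖ < σ ^ 2)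
    (hbf : b ∉ f '' G) :
    ∃ g, IsUnivalent G g ∧ g a = 0 ∧ (1 + σ ^ 2) / (2 * σ) * ‖deriv f a‖ ≤ ‖deriv g a‖ := by
  have hb1 : ‖b‖ < 1 := by nlinarith
  obtain ⟨g, hg, hg2⟩ := (hf.moebius hG hb1).exists_sqrt hG hlog fun z hz h => by
    rw [div_eq_zero_iff] at h
    rcases h with h | h
    · exact hbf ⟨z, hz, sub_eq_zero.1 h⟩
    · exact one_sub_conj_mul_ne_zero hb1 (by simpa using hf.maps hz) h
  have hβ1 : ‖g a‖ < 1 := by simpa using hg.maps ha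
  have hb0 : b ≠ 0 := fun h => hbf ⟨a, ha, by rw [hfa, h]⟩
  obtain ⟨h1, h2⟩ := hg2 a ha
  rw [(hf.hasDerivAt_moebius_comp hG hb1 ha).deriv] at h2
  simp only [hfa, mul_zero, sub_zero, zero_sub, div_one, one_pow] at h1 h2
  set x := ‖g a‖ with hx
  have hbx : ‖b‖ = x ^ 2 := by rw [hx, ← norm_pow, h1, norm_neg]
  have hx0 : 0 < x := by
    rcases (norm_nonneg (g a)).eq_or_lt with h | h
    · exfalso
      rw [← hx] at h
      rw [← h] at hbx
      simp [hb0] at hbx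
    · exact h
  have hxσ : x < σ := by
    rw [hbx] at hb
    exact lt_of_pow_lt_pow_left₀ 2 hσ0.le hb
  refine ⟨_, hg.moebius hG hβ1, by simp, ?_⟩
  rw [(hg.hasDerivAt_moebius_comp hG hβ1 ha).deriv]
  have h3 : (2 * x) * ‖deriv g a‖ = (1 - x ^ 4) * ‖deriv f a‖ := by
    have := congrArg norm h2
    rw [norm_mul, norm_mul, norm_mul] at this
    have h4 : ‖(1 - (‖b‖ : ℂ) ^ 2)‖ = 1 - x ^ 4 := by
      rw [hbx]
      have : (1 - ((x ^ 2 : ℝ) : ℂ) ^ 2) = ((1 - x ^ 4 : ℝ) : ℂ) := by push_cast; ring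
      rw [this, norm_real, Real.norm_of_nonneg]
      have : x ^ 4 ≤ 1 := pow_le_one₀ hx0.le hβ1.le
      linarith
    rw [h4] at this
    simpa using this
  have hx2 : x ^ 2 < 1 := by nlinarith
  have h5 : (1 - conj (g a) * g a) = ((1 - x ^ 2 : ℝ) : ℂ) := by
    rw [conj_mul']; push_cast; rfl
  have h6 : (1 - (x : ℂ) ^ 2) = ((1 - x ^ 2 : ℝ) : ℂ) := by push_cast; rfl
  rw [norm_mul, h5, h6, ← ofReal_pow, ← ofReal_div, norm_real, Real.norm_of_nonneg (by
    have : 0 < 1 - x ^ 2 := by linarith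
    positivity)]
  have h7 : ‖deriv g a‖ = (1 - x ^ 4) * ‖deriv f a‖ / (2 * x) := by
    field_simp
    linarith
  have hx3 : (1 - x ^ 2) ≠ 0 := by linarith
  have h8 : (1 - x ^ 2) / (1 - x ^ 2) ^ 2 * ‖deriv g a‖ = (1 + x ^ 2) / (2 * x) * ‖deriv f a‖ := by
    rw [h7]
    field_simp
    ring
  rw [h8]
  gcongr ?_ * _
  rw [div_le_div_iff₀ (by positivity) (by positivity)]
  have : 0 < 1 - x * σ := by nlinarith
  nlinarith [mul_pos this (sub_pos.2 hxσ)]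

lemma rho_mul_le_of_ball_subset (hG : IsOpen G) (hf : IsUnivalent G f) {a : ℂ} (ha : a ∈ G)
    (hfa : f a = 0) {p : ℂ → ℂ} (hp : DifferentiableOn ℂ p G) (hpinj : InjOn p G) (hpa : p a = 0)
    (hmul : ∀ z ∈ G, ∀ w ∈ G, p z * p w ≠ 1) {ρ : ℝ} (hρ : 0 < ρ) (hball : ball 0 ρ ⊆ f '' G) :
    ρ * ‖deriv p a‖ ≤ ‖deriv f a‖ := by
  set F := Function.invFunOn f G with hF
  have hFG : ∀ w ∈ ball (0 : ℂ) ρ, F w ∈ G ∧ f (F w) = w := fun w hw =>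
    ⟨Function.invFunOn_mem (hball hw), Function.invFunOn_eq (hball hw)⟩
  have hFf : ∀ z ∈ G, F (f z) = z := hf.inj.leftInvOn_invFunOn
  have hFd : ∀ w ∈ ball (0 : ℂ) ρ, HasDerivAt F (deriv f (F w))⁻¹ w := by
    intro w hw
    obtain ⟨h1, h2⟩ := hFG w hw
    have hs : HasStrictDerivAt f (deriv f (F w)) (F w) :=
      (hf.diff.analyticAt (hG.mem_nhds h1)).hasStrictDerivAt
    have := hs.to_local_left_inverse (hf.deriv_ne _ h1) (g := F)
      (by filter_upwards [hG.mem_nhds h1] with z hz using hFf z hz)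
    rw [h2] at this
    exact this.hasDerivAt
  have hF0 : F 0 = a := by rw [← hfa, hFf a ha]
  have hPd : ∀ w ∈ ball (0 : ℂ) ρ, HasDerivAt (p ∘ F) (deriv p (F w) * (deriv f (F w))⁻¹) w :=
    fun w hw => HasDerivAt.comp w
      (hp.differentiableAt (hG.mem_nhds (hFG w hw).1)).hasDerivAt (hFd w hw)
  have key := norm_deriv_mul_le_one_of_mul_ne_one hρ (P := p ∘ F)
    (fun w hw => (hPd w hw).differentiableAt.differentiableWithinAt)
    (fun z hz w hw h => by
      have := hpinj (hFG z hz).1 (hFG w hw).1 h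
      rw [← (hFG z hz).2, this, (hFG w hw).2])
    (by simp [hF0, hpa])
    (fun z hz w hw => hmul _ (hFG z hz).1 _ (hFG w hw).1)
  rw [(hPd 0 (mem_ball_self hρ)).deriv, hF0, norm_mul, norm_inv] at key
  have hpos : 0 < ‖deriv f a‖ := norm_pos_iff.2 (hf.deriv_ne a ha)
  rw [← div_eq_mul_inv, div_mul_eq_mul_div, div_le_one hpos] at key
  linarith

lemma bddAbove_deriv (hG : IsOpen G) {a : ℂ} (ha : a ∈ G) :
    BddAbove {t : ℝ | ∃ f, IsUnivalent G f ∧ f a = 0 ∧ t = ‖deriv f a‖} := by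
  obtain ⟨s, hs, hsG⟩ := Metric.isOpen_iff.1 hG a ha
  refine ⟨1 / (s / 2), ?_⟩
  rintro _ ⟨f, hf, -, rfl⟩
  have hsub : closedBall a (s / 2) ⊆ G := (closedBall_subset_ball (by linarith)).trans hsG
  refine norm_deriv_le_of_forall_mem_sphere_norm_le (by positivity) ?_ fun z hz => ?_
  · apply DifferentiableOn.diffContOnCl
    rw [closure_ball _ (by positivity)]
    exact hf.diff.mono hsub
  · have := hf.maps (hsub (sphere_subset_closedBall hz))
    exact (mem_ball_zero_iff.1 this).le

end IsUnivalent

lemma exists_isUnivalent_of_mul_ne_one {G : Set ℂ} (hG : IsOpen G)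
    (hlog : HasContLog G) {a : ℂ} (ha : a ∈ G) {p : ℂ → ℂ} (hp : DifferentiableOn ℂ p G)
    (hpinj : InjOn p G) (hpa : p a = 0) (hpd : ∀ z ∈ G, deriv p z ≠ 0)
    (hmul : ∀ z ∈ G, ∀ w ∈ G, p z * p w ≠ 1) {η : ℝ} (hη : η < ‖deriv p a‖) :
    ∃ f, IsUnivalent G f ∧ f a = 0 ∧ η ≤ ‖deriv f a‖ := by
  by_contra! hcon
  set T := {t : ℝ | ∃ f, IsUnivalent G f ∧ f a = 0 ∧ t = ‖deriv f a‖} with hT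
  have hbdd : BddAbove T := IsUnivalent.bddAbove_deriv hG ha
  obtain ⟨f₀, hf₀, hf₀a⟩ : ∃ f, IsUnivalent G f ∧ f a = 0 := by
    have hs : HasStrictDerivAt p (deriv p a) a :=
      (hp.analyticAt (hG.mem_nhds ha)).hasStrictDerivAt
    have himg : p '' G ∈ 𝓝 (0 : ℂ) := by
      rw [← hpa, ← hs.map_nhds_eq (hpd a ha)]
      exact Filter.image_mem_map (hG.mem_nhds ha)
    obtain ⟨s, hs0, hsG⟩ := Metric.mem_nhds_iff.1 himg
    have hbound : ∀ z ∈ G, ‖p z‖ * s ≤ 1 := by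
      intro z hz
      by_contra! h
      have hpz : 0 < ‖p z‖ := by
        by_contra! h'
        nlinarith [norm_nonneg (p z)]
      obtain ⟨w, hw, hwz⟩ := hsG (show (p z)⁻¹ ∈ ball (0 : ℂ) s by
        rw [mem_ball_zero_iff, norm_inv, inv_lt_iff_one_lt_mul₀ hpz]
        linarith)
      exact hmul z hz w hw (by rw [hwz, mul_inv_cancel₀ (norm_pos_iff.1 hpz)])
    have hc : ((s / 2 : ℝ) : ℂ) ≠ 0 := by
      exact_mod_cast (half_pos hs0).ne'
    refine ⟨fun z => ((s / 2 : ℝ) : ℂ) * p z, ⟨hp.const_mul _, ?_, ?_, ?_⟩, by simp [hpa]⟩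
    · exact fun z hz w hw h => hpinj hz hw (mul_left_cancel₀ hc h)
    · intro z hz
      rw [mem_ball_zero_iff, norm_mul, norm_real, Real.norm_of_nonneg (by positivity)]
      have := hbound z hz
      nlinarith
    · intro z hz
      rw [deriv_const_mul _ (hp.differentiableAt (hG.mem_nhds hz))]
      exact mul_ne_zero hc (hpd z hz)
  have hpos : 0 < ‖deriv f₀ a‖ := norm_pos_iff.2 (hf₀.deriv_ne a ha)
  have hM : 0 < sSup T := hpos.trans_le (le_csSup hbdd ⟨f₀, hf₀, hf₀a, rfl⟩)
  have hη0 : 0 < η := hpos.trans (hcon f₀ hf₀ hf₀a)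
  obtain ⟨σ, ⟨hσ1, hσ⟩, hσ0⟩ : ∃ σ : ℝ, (σ < 1 ∧ η < σ ^ 2 * ‖deriv p a‖) ∧ 0 < σ := by
    have h1 : ∀ᶠ σ in 𝓝[<] (1 : ℝ), η < σ ^ 2 * ‖deriv p a‖ := by
      apply nhdsWithin_le_nhds
      have : ContinuousAt (fun σ : ℝ => σ ^ 2 * ‖deriv p a‖) 1 := by fun_prop
      exact this.eventually (lt_mem_nhds (by simpa using hη))
    have h2 : ∀ᶠ σ in 𝓝[<] (1 : ℝ), 0 < σ :=
      nhdsWithin_le_nhds (lt_mem_nhds one_pos)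
    have h3 : ∀ᶠ σ in 𝓝[<] (1 : ℝ), σ < 1 := self_mem_nhdsWithin
    exact ((h3.and h1).and h2).exists
  have hκ : 1 < (1 + σ ^ 2) / (2 * σ) := by
    rw [one_lt_div (by positivity)]
    nlinarith [mul_pos (sub_pos.2 hσ1) (sub_pos.2 hσ1)]
  have hstep : sSup T ≤ sSup T / ((1 + σ ^ 2) / (2 * σ)) := by
    refine csSup_le (show T.Nonempty from ⟨_, f₀, hf₀, hf₀a, rfl⟩) ?_
    rintro _ ⟨f, hf, hfa, rfl⟩
    have hnot : ¬ ball 0 (σ ^ 2) ⊆ f '' G := by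
      intro hball
      have := hf.rho_mul_le_of_ball_subset hG ha hfa hp hpinj hpa hmul (by positivity) hball
      linarith [hcon f hf hfa]
    obtain ⟨b, hb, hbf⟩ := Set.not_subset.1 hnot
    obtain ⟨g, hg, hga, hle⟩ := hf.exists_larger_deriv hG hlog ha hfa hσ1 hσ0 (by simpa using hb) hbf
    rw [le_div_iff₀ (by linarith), mul_comm]
    exact hle.trans (le_csSup hbdd ⟨g, hg, hga, rfl⟩)
  rw [le_div_iff₀ (by linarith)] at hstep
  nlinarith

/-- Koebe's quarter theorem, as a lower bound for the derivative of univalent maps to the disc. -/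
lemma exists_isUnivalent_deriv_ge {G : Set ℂ} (hG : IsOpen G) (hlog : HasContLog G)
    (h1 : (1 : ℂ) ∈ G) (h0 : (0 : ℂ) ∉ G) {η : ℝ} (hη : η < 1 / 4) :
    ∃ f, IsUnivalent G f ∧ f 1 = 0 ∧ η ≤ ‖deriv f 1‖ := by
  obtain ⟨k, hk, hk2⟩ := hlog.exists_sqrt hG (F := fun z => z) differentiableOn_id
    fun z hz h => h0 (h ▸ hz)
  have hk1 : k 1 ^ 2 = 1 := hk2 1 h1
  have hk10 : k 1 ≠ 0 := by
    intro h; rw [h] at hk1; norm_num at hk1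
  set h : ℂ → ℂ := fun z => k z / k 1 with hh
  have hhd : DifferentiableOn ℂ h G := hk.div_const _
  have hh2 : ∀ z ∈ G, h z ^ 2 = z := fun z hz => by
    rw [hh]
    simp only [div_pow, hk1, div_one]
    exact hk2 z hz
  have hh1 : h 1 = 1 := div_self hk10
  have hneg : ∀ z ∈ G, ∀ w ∈ G, h z + h w ≠ 0 := by
    intro z hz w hw hzw
    have hzw' : h z = -h w := eq_neg_of_add_eq_zero_left hzw
    have : z = w := by rw [← hh2 z hz, hzw', neg_sq, hh2 w hw]
    subst this
    have h3 : h z = 0 := by linear_combination hzw / 2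
    apply h0
    have := hh2 z hz
    rw [h3] at this
    have hz0 : z = 0 := by rw [← this]; simp
    exact hz0 ▸ hz
  have hp1 : ∀ z ∈ G, h z + 1 ≠ 0 := fun z hz => by
    have := hneg z hz 1 h1
    rwa [hh1] at this
  have hder : ∀ z ∈ G, 2 * h z * deriv h z = 1 := by
    intro z hz
    have e1 : HasDerivAt (fun z => h z ^ 2) (2 * h z * deriv h z) z := by
      exact ((hhd.differentiableAt (hG.mem_nhds hz)).hasDerivAt.fun_pow 2).congr_deriv (by simp)
    have e2 : (fun z => h z ^ 2) =ᶠ[𝓝 z] fun z => z := by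
      filter_upwards [hG.mem_nhds hz] with w hw using hh2 w hw
    rw [← e1.deriv, e2.deriv_eq]
    simp
  have hpder : ∀ z ∈ G, HasDerivAt (fun z => (h z - 1) / (h z + 1))
      (2 * deriv h z / (h z + 1) ^ 2) z := by
    intro z hz
    have hz' := (hhd.differentiableAt (hG.mem_nhds hz)).hasDerivAt
    refine ((hz'.sub_const 1).fun_div (hz'.add_const 1) (hp1 z hz)).congr_deriv ?_
    congr 1
    ring
  refine exists_isUnivalent_of_mul_ne_one hG hlog h1 (p := fun z => (h z - 1) / (h z + 1))
    (fun z hz => (hpder z hz).differentiableAt.differentiableWithinAt) ?_ (by simp [hh1]) ?_ ?_ ?_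
  · intro z hz w hw hzw
    dsimp only at hzw
    rw [div_eq_div_iff (hp1 z hz) (hp1 w hw)] at hzw
    have : h z = h w := by linear_combination hzw / 2
    rw [← hh2 z hz, this, hh2 w hw]
  · intro z hz
    rw [(hpder z hz).deriv]
    refine div_ne_zero (mul_ne_zero two_ne_zero fun h' => ?_) (pow_ne_zero _ (hp1 z hz))
    have := hder z hz
    rw [h', mul_zero] at this
    exact zero_ne_one this
  · intro z hz w hw hzw
    rw [div_mul_div_comm, div_eq_one_iff_eq (mul_ne_zero (hp1 z hz) (hp1 w hw))] at hzw
    exact hneg z hz w hw (by linear_combination -hzw / 2)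
  · rw [(hpder 1 h1).deriv, hh1]
    have := hder 1 h1
    rw [hh1, mul_one] at this
    rw [this]
    norm_num
    linarith

section Frame

open Matrix

variable {n : ℕ} {E : Set (Fin n → ℂ)}

lemma isClosed_setOf_forall_dotProduct_ne_one (hE : IsOpen E) :
    IsClosed {a : Fin n → ℂ | ∀ w ∈ E, a ⬝ᵥ w ≠ 1} := by
  rw [← isOpen_compl_iff, isOpen_iff_mem_nhds]
  intro a ha
  simp only [mem_compl_iff, mem_ofPred_eq, not_forall, not_not] at ha
  obtain ⟨w, hw, haw⟩ := ha
  have hc : ContinuousAt (fun b : Fin n → ℂ => b ⬝ᵥ w) a :=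
    (continuous_id.dotProduct continuous_const).continuousAt
  have h1 : ∀ᶠ b in 𝓝 a, b ⬝ᵥ w ≠ 0 := by
    apply hc.eventually_ne
    rw [haw]
    exact one_ne_zero
  have h2 : ContinuousAt (fun b : Fin n → ℂ => (b ⬝ᵥ w)⁻¹ • w) a :=
    (hc.inv₀ (by rw [haw]; exact one_ne_zero)).smul continuousAt_const
  have h3 : ∀ᶠ b in 𝓝 a, (b ⬝ᵥ w)⁻¹ • w ∈ E := by
    apply h2.eventually
    dsimp only
    rw [haw, inv_one, one_smul]
    exact hE.mem_nhds hw
  filter_upwards [h1, h3] with b hb1 hb3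
  simp only [mem_compl_iff, mem_ofPred_eq, not_forall, not_not]
  exact ⟨_, hb3, by rw [dotProduct_smul, smul_eq_mul, inv_mul_cancel₀ hb1]⟩

lemma isCompact_setOf_forall_dotProduct_ne_one (hE : IsOpen E) (h0 : 0 ∈ E) :
    IsCompact {a : Fin n → ℂ | ∀ w ∈ E, a ⬝ᵥ w ≠ 1} := by
  obtain ⟨r, hr, hball⟩ := Metric.isOpen_iff.1 hE 0 h0
  refine Metric.isCompact_of_isClosed_isBounded (isClosed_setOf_forall_dotProduct_ne_one hE)
    (Metric.isBounded_closedBall (x := 0) (r := 1 / r) |>.subset fun a ha => ?_)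
  rw [mem_closedBall_zero_iff, pi_norm_le_iff_of_nonneg (by positivity)]
  intro i
  by_contra! hi
  have hai : a i ≠ 0 := by
    intro h
    rw [h, norm_zero] at hi
    exact (hi.trans' (by positivity)).false
  refine ha (Pi.single i (a i)⁻¹) (hball ?_) (by simp [hai])
  rw [mem_ball_zero_iff, Pi.norm_single, norm_inv]
  exact inv_lt_of_inv_lt₀ hr (by simpa using hi)

lemma LineConvex.exists_dotProduct (h : LineConvex E) (hE : IsOpen E) (h0 : 0 ∈ E)
    {w : Fin n → ℂ} (hw : w ∉ E) : ∃ a : Fin n → ℂ, (∀ v ∈ E, a ⬝ᵥ v ≠ 1) ∧ a ⬝ᵥ w = 1 := by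
  obtain ⟨l, hl1, hl⟩ := h.exists_separating hE hw h0
  have key : ∀ v, (fun i => l (Pi.single i 1)) ⬝ᵥ v = l v := by
    intro v
    conv_rhs => rw [pi_eq_sum_univ' v, map_sum]
    simp only [dotProduct, map_smul, smul_eq_mul]
    refine Finset.sum_congr rfl fun i _ => ?_
    rw [mul_comm]
  refine ⟨fun i => l (Pi.single i 1), fun v hv => ?_, ?_⟩
  · rw [key]
    simpa using hl v hv
  · rw [key]
    simpa using hl1

lemma LineConvex.exists_det_ne_zero (h : LineConvex E) (hE : IsOpen E) (h0 : 0 ∈ E)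
    (hno : ∀ u ≠ 0, ∃ t : ℂ, t • u ∉ E) :
    ∃ A : Matrix (Fin n) (Fin n) ℂ, (∀ j, ∀ w ∈ E, A j ⬝ᵥ w ≠ 1) ∧ A.det ≠ 0 := by
  set S : Set (Fin n → ℂ) := {a | ∀ w ∈ E, a ⬝ᵥ w ≠ 1} with hS
  have hspan : Submodule.span ℂ S = ⊤ := by
    by_contra hne
    obtain ⟨f, hf0, hf⟩ := Submodule.exists_le_ker_of_lt_top _ (lt_top_iff_ne_top.2 hne)
    have key : ∀ a : Fin n → ℂ, f a = a ⬝ᵥ (fun i => f (Pi.single i 1)) := by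
      intro a
      conv_lhs => rw [pi_eq_sum_univ' a, map_sum]
      simp only [dotProduct, map_smul, smul_eq_mul]
    have hu : (fun i => f (Pi.single i 1)) ≠ 0 := by
      intro hu
      apply hf0
      refine LinearMap.ext fun a => ?_
      rw [key, hu, dotProduct_zero, LinearMap.zero_apply]
    obtain ⟨t, ht⟩ := hno _ hu
    obtain ⟨a, haS, ha⟩ := h.exists_dotProduct hE h0 ht
    have := hf (Submodule.subset_span haS)
    rw [LinearMap.mem_ker, key] at this
    rw [dotProduct_smul, this, smul_zero] at ha
    exact zero_ne_one ha
  obtain ⟨f, hfS, -, hli⟩ := Submodule.exists_fun_fin_finrank_span_eq ℂ S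
  have hdim : Module.finrank ℂ (Submodule.span ℂ S) = n := by
    rw [hspan, finrank_top, Module.finrank_fin_fun]
  let A : Matrix (Fin n) (Fin n) ℂ := fun j => f (Fin.cast hdim.symm j)
  refine ⟨A, fun j => hfS _, ?_⟩
  have : LinearIndependent ℂ A.row :=
    hli.comp (Fin.cast hdim.symm) (Fin.cast_injective _)
  rw [Matrix.linearIndependent_rows_iff_isUnit, Matrix.isUnit_iff_isUnit_det] at this
  exact this.ne_zero

/-- A linear frame adapted to `E`: the coordinates omit the value `1` on `E` and their unit
`ℓ¹`-ball lies in `E`. -/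
lemma LineConvex.exists_linearEquiv (h : LineConvex E) (hE : IsOpen E) (h0 : 0 ∈ E)
    (hno : ∀ u ≠ 0, ∃ t : ℂ, t • u ∉ E) :
    ∃ T : (Fin n → ℂ) ≃ₗ[ℂ] (Fin n → ℂ), (∀ j, ∀ w ∈ E, T w j ≠ 1) ∧
      ∀ w, ∑ j, ‖T w j‖ < 1 → w ∈ E := by
  set S : Set (Fin n → ℂ) := {a | ∀ w ∈ E, a ⬝ᵥ w ≠ 1} with hS
  have hK : IsCompact {A : Matrix (Fin n) (Fin n) ℂ | ∀ j, A j ∈ S} :=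
    isCompact_pi_infinite fun _ => isCompact_setOf_forall_dotProduct_ne_one hE h0
  obtain ⟨B, hBS, hB⟩ := h.exists_det_ne_zero hE h0 hno
  obtain ⟨A, hAS, hA⟩ := hK.exists_isMaxOn ⟨B, hBS⟩
    (f := fun A => ‖A.det‖) (Continuous.continuousOn (by fun_prop))
  have hpos : 0 < ‖A.det‖ := (norm_pos_iff.2 hB).trans_le (hA hBS)
  have hdet : A.det ≠ 0 := norm_pos_iff.1 hpos
  let _ := A.invertibleOfIsUnitDet hdet.isUnit
  have hT : ∀ w j, A.toLinearEquiv' ‹_› w j = A j ⬝ᵥ w := fun w j => rfl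
  refine ⟨A.toLinearEquiv' ‹_›, fun j w hw => ?_, fun w hw => ?_⟩
  · rw [hT]
    exact hAS j w hw
  · by_contra hwE
    obtain ⟨a, haS, ha⟩ := h.exists_dotProduct hE h0 hwE
    have hc : ∀ j, ‖cramer Aᵀ a j‖ ≤ ‖A.det‖ := by
      intro j
      rw [cramer_transpose_apply]
      refine hA fun i => ?_
      rcases eq_or_ne i j with rfl | hij
      · rw [updateRow_self]
        exact haS
      · rw [updateRow_ne hij]
        exact hAS i
    have h1 : Aᵀ *ᵥ cramer Aᵀ a = A.det • a := by
      rw [mulVec_cramer, det_transpose]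
    have h2 : A.det = ∑ j, cramer Aᵀ a j * (A j ⬝ᵥ w) := by
      calc A.det = (A.det • a) ⬝ᵥ w := by rw [smul_dotProduct, ha, smul_eq_mul, mul_one]
        _ = cramer Aᵀ a ⬝ᵥ (A *ᵥ w) := by
            rw [← h1, mulVec_transpose, dotProduct_mulVec]
        _ = _ := rfl
    have h3 : ‖A.det‖ ≤ ‖A.det‖ * ∑ j, ‖A j ⬝ᵥ w‖ := by
      conv_lhs => rw [h2]
      rw [Finset.mul_sum]
      refine (norm_sum_le _ _).trans (Finset.sum_le_sum fun j _ => ?_)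
      rw [norm_mul]
      gcongr
      exact hc j
    simp only [hT] at hw
    have := (mul_lt_mul_iff_of_pos_left hpos).2 hw
    linarith

end Frame

section Caratheodory

variable {n : ℕ} {D : Set (Cn n)} {z : Cn n}

lemma norm_fderiv_le_of_forall_disc (hD : IsOpen D) {h : Cn n → ℂ} (hh : DifferentiableOn ℂ h D)
    {X : Cn n} {R C : ℝ} (hR : 0 < R) (hmem : ∀ s : ℂ, ‖s‖ ≤ R → z + s • X ∈ D)
    (hC : ∀ s : ℂ, ‖s‖ ≤ R → ‖h (z + s • X)‖ ≤ C) : ‖fderiv ℂ h z X‖ ≤ C / R := by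
  have hz : z ∈ D := by simpa using hmem 0 (by simpa using hR.le)
  have hline : ∀ s : ℂ, HasDerivAt (fun s : ℂ => z + s • X) X s := fun s => by
    simpa using ((hasDerivAt_id s).smul_const X).const_add z
  have hder : deriv (fun s : ℂ => h (z + s • X)) 0 = fderiv ℂ h z X := by
    have h1 : HasFDerivAt h (fderiv ℂ h z) (z + (0 : ℂ) • X) := by
      rw [zero_smul, add_zero]
      exact (hh.differentiableAt (hD.mem_nhds hz)).hasFDerivAt
    exact (h1.comp_hasDerivAt (0 : ℂ) (hline 0)).deriv
  rw [← hder]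
  refine norm_deriv_le_of_forall_mem_sphere_norm_le hR ?_ fun s hs => hC s ?_
  · apply DifferentiableOn.diffContOnCl
    rw [closure_ball _ hR.ne']
    intro s hs
    refine (DifferentiableAt.comp s (f := fun s : ℂ => z + s • X) ?_
      (hline s).differentiableAt).differentiableWithinAt
    exact hh.differentiableAt (hD.mem_nhds (hmem s (by simpa using hs)))
  · simpa using hs.le

lemma exists_forall_disc_mem (hD : IsOpen D) (hz : z ∈ D) (X : Cn n) :
    ∃ R > 0, ∀ s : ℂ, ‖s‖ ≤ R → z + s • X ∈ D := by
  have hopen : IsOpen {s : ℂ | z + s • X ∈ D} := hD.preimage (by fun_prop)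
  obtain ⟨R, hR, hsub⟩ := Metric.nhds_basis_closedBall.mem_iff.1
    (hopen.mem_nhds (show (0 : ℂ) ∈ {s : ℂ | z + s • X ∈ D} by simpa using hz))
  exact ⟨R, hR, fun s hs => hsub (by simpa using hs)⟩

lemma le_caraMetric (hD : IsOpen D) (hz : z ∈ D) (X : Cn n) {f : Cn n → ℂ}
    (hf : DifferentiableOn ℂ f D) (hfD : MapsTo f D (ball (0 : ℂ) 1)) (hfz : f z = 0) :
    ‖fderiv ℂ f z X‖ ≤ caraMetric D z X := by
  obtain ⟨R, hR, hmem⟩ := exists_forall_disc_mem hD hz X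
  refine le_csSup ⟨1 / R, ?_⟩ ⟨f, hf, hfD, hfz, rfl⟩
  rintro _ ⟨g, hg, hgD, -, rfl⟩
  exact norm_fderiv_le_of_forall_disc hD hg hR hmem fun s hs =>
    (mem_ball_zero_iff.1 (hgD (hmem s hs))).le

lemma LineConvex.exists_isUnivalent (h : LineConvex D) (hD : IsOpen D) (hz : z ∈ D)
    {l : Cn n →ₗ[ℂ] ℂ} {v : Cn n} (hv : l v = 1) (hl : ∀ w ∈ D, l (w - z) ≠ 1)
    {η : ℝ} (hη : η < 1 / 4) :
    ∃ (G : Set ℂ) (f : ℂ → ℂ), IsOpen G ∧ IsUnivalent G f ∧ f 1 = 0 ∧ η ≤ ‖deriv f 1‖ ∧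
      (1 : ℂ) ∈ G ∧ ∀ w ∈ D, 1 - l (w - z) ∈ G := by
  set D' : Set (Cn n) := {x | (z + v) + (-LinearMap.id : Cn n →ₗ[ℂ] Cn n) x ∈ D} with hD'
  have hlc : LineConvex D' := h.preimage_affine _ _
  have hD'o : IsOpen D' := hD.preimage (by
    simp only [LinearMap.neg_apply, LinearMap.id_apply]
    fun_prop)
  have hsurj : Function.Surjective l := fun t => ⟨t • v, by simp [hv]⟩
  have hG : IsOpen (l '' D') := l.isOpenMap_of_finiteDimensional hsurj _ hD'o
  have hmem : ∀ w ∈ D, 1 - l (w - z) ∈ l '' D' := fun w hw =>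
    ⟨z + v - w, by simpa [hD'] using hw, by simp [hv]; ring⟩
  have h1 : (1 : ℂ) ∈ l '' D' := by simpa using hmem z hz
  have h0 : (0 : ℂ) ∉ l '' D' := by
    rintro ⟨x, hx, hx0⟩
    refine hl _ hx ?_
    simp [hv, hx0]
  obtain ⟨f, hf, hf1, hfη⟩ := exists_isUnivalent_deriv_ge hG (hlc.image_dual hD'o hv).2 h1 h0 hη
  exact ⟨_, f, hG, hf, hf1, hfη, h1, hmem⟩

lemma norm_div_four_le_caraMetric (h : LineConvex D) (hD : IsOpen D) (hz : z ∈ D)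
    {l : Cn n →ₗ[ℂ] ℂ} {v : Cn n} (hv : l v = 1) (hl : ∀ w ∈ D, l (w - z) ≠ 1) (X : Cn n) :
    ‖l X‖ / 4 ≤ caraMetric D z X := by
  have key : ∀ η < 1 / 4, η * ‖l X‖ ≤ caraMetric D z X := by
    intro η hη
    obtain ⟨G, f, hG, hf, hf1, hfη, h1, hmem⟩ := h.exists_isUnivalent hD hz hv hl hη
    have hlin : ∀ w, HasFDerivAt (fun w => 1 - l (w - z)) (-l.toContinuousLinearMap) w := fun w =>
      ((l.toContinuousLinearMap.hasFDerivAt.comp w ((hasFDerivAt_id w).sub_const z)).const_sub 1)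
    have hdf : ∀ w ∈ D, HasDerivAt f (deriv f (1 - l (w - z))) (1 - l (w - z)) := fun w hw =>
      (hf.diff.differentiableAt (hG.mem_nhds (hmem w hw))).hasDerivAt
    have hF : ∀ w ∈ D, HasFDerivAt (fun w => f (1 - l (w - z)))
        (deriv f (1 - l (w - z)) • (-l.toContinuousLinearMap)) w := fun w hw =>
      (hdf w hw).comp_hasFDerivAt w (hlin w)
    have := le_caraMetric hD hz X (f := fun w => f (1 - l (w - z)))
      (fun w hw => (hF w hw).differentiableAt.differentiableWithinAt)
      (fun w hw => hf.maps (hmem w hw)) (by simpa using hf1)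
    rw [(hF z hz).fderiv] at this
    simp only [sub_self, map_zero, sub_zero, _root_.smul_apply, smul_eq_mul,
      _root_.neg_apply, norm_mul, norm_neg, LinearMap.coe_toContinuousLinearMap'] at this
    exact (mul_le_mul_of_nonneg_right hfη (norm_nonneg _)).trans this
  by_contra! hlt
  have hpos : 0 < ‖l X‖ := by
    have := key 0 (by norm_num)
    rw [zero_mul] at this
    linarith
  have h2 := key ((caraMetric D z X / ‖l X‖ + 1 / 4) / 2) (by
    have : caraMetric D z X / ‖l X‖ < 1 / 4 := by
      rw [div_lt_iff₀ hpos]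
      linarith
    linarith)
  have h3 : (caraMetric D z X / ‖l X‖ + 1 / 4) / 2 * ‖l X‖ =
      (caraMetric D z X + ‖l X‖ / 4) / 2 := by
    field_simp
  linarith

lemma kobMetric_le_four_mul_caraMetric (h : LineConvex D) (hD : IsOpen D) (hno : NoComplexLine D)
    (hz : z ∈ D) {X : Cn n} (hX : X ≠ 0) : kobMetric D z X ≤ 4 * caraMetric D z X := by
  set F : Set ℂ := {t : ℂ | z + t • X ∈ D}ᶜ with hF
  have hFc : IsClosed F := (hD.preimage (f := fun t : ℂ => z + t • X) (by fun_prop)).isClosed_compl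
  have hFne : F.Nonempty := by
    by_contra hne
    rw [not_nonempty_iff_eq_empty] at hne
    refine hno ⟨z, X, hX, ?_⟩
    rintro _ ⟨t, rfl⟩
    by_contra ht
    exact (hne ▸ (show t ∈ F from ht) : t ∈ (∅ : Set ℂ))
  obtain ⟨t₀, ht₀, hdist⟩ := hFc.exists_infDist_eq_dist hFne 0
  have ht0 : t₀ ≠ 0 := by
    rintro rfl
    apply ht₀
    simpa using hz
  have hpos : 0 < ‖t₀‖ := norm_pos_iff.2 ht0
  have hdisc : ∀ t : ℂ, ‖t‖ < ‖t₀‖ → z + t • X ∈ D := by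
    intro t ht
    by_contra htF
    have := Metric.infDist_le_dist_of_mem (x := 0) (show t ∈ F from htF)
    rw [hdist, dist_zero_left, dist_zero_left] at this
    linarith
  obtain ⟨l, hl1, hl⟩ := h.exists_separating hD (show z + t₀ • X ∉ D from ht₀) hz
  rw [add_sub_cancel_left] at hl1
  have hlX : ‖l X‖ = ‖t₀‖⁻¹ := by
    rw [map_smul, smul_eq_mul] at hl1
    rw [eq_inv_of_mul_eq_one_right hl1, norm_inv]
  have h1 := norm_div_four_le_caraMetric h hD hz hl1 hl X
  have h2 : kobMetric D z X ≤ ‖t₀‖⁻¹ := by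
    refine csInf_le ⟨0, fun a ha => ha.1⟩ ⟨by positivity, fun t => z + (t * ‖t₀‖) • X, ?_, ?_, ?_⟩
    · fun_prop
    · intro t ht
      apply hdisc
      rw [norm_mul, norm_real, norm_norm]
      rw [mem_ball_zero_iff] at ht
      nlinarith
    · have hd : HasDerivAt (fun t : ℂ => z + (t * ‖t₀‖) • X) (((1 : ℂ) * ‖t₀‖) • X) 0 :=
        ((((hasDerivAt_id (0 : ℂ)).mul_const _).smul_const X).const_add z)
      rw [fderiv_apply_one_eq_deriv, hd.deriv, one_mul, ← Complex.coe_smul, smul_smul]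
      rw [← ofReal_mul, inv_mul_cancel₀ hpos.ne', ofReal_one, one_smul]
      simp
  linarith

end Caratheodory

lemma lintegral_fin_prod_eq_prod {n : ℕ} {F : Fin n → ℂ → ENNReal} (hF : ∀ i, Measurable (F i)) :
    ∫⁻ x : Fin n → ℂ, ∏ i, F i (x i) = ∏ i, ∫⁻ x, F i x := by
  induction n with
  | zero => simp [volume_pi]
  | succ n ih =>
    have hmp := (volume_preserving_piFinSuccAbove (fun _ : Fin (n + 1) => ℂ) 0).symm
    rw [← hmp.lintegral_comp_emb (MeasurableEquiv.measurableEmbedding _), Fin.prod_univ_succ,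
      ← ih fun i => hF i.succ, Measure.volume_eq_prod, ← lintegral_prod_mul (hF 0).aemeasurable
        (Finset.measurable_prod _ fun i _ => (hF i.succ).comp (measurable_pi_apply i)).aemeasurable]
    refine lintegral_congr fun x => ?_
    simp_rw [MeasurableEquiv.piFinSuccAbove_symm_apply, Fin.insertNthEquiv,
      Fin.prod_univ_succ, Fin.insertNth_zero, Equiv.coe_fn_mk, Fin.cons_succ, Fin.cons_zero]
    rfl

/-- A linear coordinate system centred at `z` and adapted to `D`: no coordinate takes the value
`1` on `D`, while `D` contains the unit `ℓ¹`-ball. -/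
structure IsFrame {n : ℕ} (D : Set (Cn n)) (z : Cn n) (L : Cn n ≃L[ℂ] (Fin n → ℂ)) : Prop where
  ne_one : ∀ j, ∀ w ∈ D, L (w - z) j ≠ 1
  mem : ∀ w, ∑ j, ‖L w j‖ < 1 → z + w ∈ D

section BergmanEstimates

variable {n : ℕ} {D : Set (Cn n)} {z : Cn n}

lemma LineConvex.exists_isFrame (h : LineConvex D) (hD : IsOpen D) (hno : NoComplexLine D)
    (hz : z ∈ D) : ∃ L : Cn n ≃L[ℂ] (Fin n → ℂ), IsFrame D z L := by
  set e : Cn n ≃ₗ[ℂ] (Fin n → ℂ) := WithLp.linearEquiv 2 ℂ (Fin n → ℂ) with he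
  have hec : Continuous e.symm := e.symm.toLinearMap.continuous_of_finiteDimensional
  have hE : IsOpen {v | z + e.symm.toLinearMap v ∈ D} := hD.preimage (continuous_const.add hec)
  obtain ⟨T, hT1, hT2⟩ := (h.preimage_affine z e.symm.toLinearMap).exists_linearEquiv hE
    (by simpa using hz) (by
      intro u hu
      by_contra! hcon
      refine hno ⟨z, e.symm u, by simpa using hu, ?_⟩
      rintro _ ⟨t, rfl⟩
      simpa using hcon t)
  refine ⟨(e.trans T).toContinuousLinearEquiv, fun j w hw => hT1 j (e (w - z)) ?_, fun w hw => ?_⟩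
  · simpa using hw
  · simpa using hT2 (e w) hw

lemma exists_map_volume_eq_smul (L : Cn n ≃L[ℂ] (Fin n → ℂ)) :
    ∃ κ : NNReal, 0 < κ ∧ Measure.map L volume = κ • (volume : Measure (Fin n → ℂ)) := by
  have := L.isAddHaarMeasure_map (volume : Measure (Cn n))
  exact ⟨_, Measure.addHaarScalarFactor_pos_of_isAddHaarMeasure _ _,
    Measure.isAddLeftInvariant_eq_smul _ _⟩

lemma volume_preimage_ball {L : Cn n ≃L[ℂ] (Fin n → ℂ)} {κ : NNReal}
    (hκ : Measure.map L volume = κ • (volume : Measure (Fin n → ℂ))) {ρ : ℝ} (hρ : 0 < ρ) :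
    volume {w | ‖L w‖ < ρ} = ENNReal.ofReal (κ * Real.pi ^ n * ρ ^ (2 * n)) := by
  have h1 : {w | ‖L w‖ < ρ} = L ⁻¹' ball 0 ρ := by
    ext w
    simp
  rw [h1, ← Measure.map_apply L.continuous.measurable measurableSet_ball, hκ, Measure.smul_apply,
    volume_pi_ball _ hρ]
  simp only [Pi.zero_apply, Complex.volume_ball, Finset.prod_const, Finset.card_univ,
    Fintype.card_fin]
  rw [mul_assoc, ENNReal.ofReal_mul κ.coe_nonneg, ENNReal.ofReal_mul (by positivity),
    ENNReal.ofReal_pow Real.pi_pos.le, ENNReal.ofReal_pow hρ.le, ENNReal.ofReal_coe_nnreal,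
    ← NNReal.coe_real_pi, ENNReal.ofReal_coe_nnreal, mul_pow, ← pow_mul, mul_comm (_ ^ (2 * n))]
  rfl

lemma measurePreserving_smul_Cn {c : ℂ} (hc : ‖c‖ = 1) :
    MeasurePreserving (fun w : Cn n => c • w) volume volume := by
  have h0 : c ≠ 0 := by rintro rfl; simp at hc
  let e : Cn n ≃ₗᵢ[ℝ] Cn n :=
    { (LinearEquiv.smulOfNeZero ℂ (Cn n) c h0).restrictScalars ℝ with
      norm_map' := fun w => by
        change ‖c • w‖ = ‖w‖
        rw [norm_smul, hc, one_mul] }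
  exact e.measurePreserving

lemma lintegral_enorm_sq_eq {μ : Measure (Cn n)} {h : Cn n → ℂ}
    (hi : Integrable (fun w => ‖h w‖ ^ 2) μ) :
    ∫⁻ w, ‖h w‖ₑ ^ 2 ∂μ = ENNReal.ofReal (∫ w, ‖h w‖ ^ 2 ∂μ) := by
  rw [ofReal_integral_eq_lintegral_ofReal hi (.of_forall fun w => by positivity)]
  refine lintegral_congr fun w => ?_
  rw [ENNReal.ofReal_pow (norm_nonneg _), ofReal_norm]

lemma integrableOn_norm_sq_of_lintegral_le (hD : IsOpen D) {h : Cn n → ℂ}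
    (hh : DifferentiableOn ℂ h D) {C : ℝ} (hC : 0 ≤ C)
    (hle : ∫⁻ w in D, ‖h w‖ₑ ^ 2 ≤ ENNReal.ofReal C) :
    IntegrableOn (fun w => ‖h w‖ ^ 2) D ∧ ∫ w in D, ‖h w‖ ^ 2 ≤ C := by
  have hm : AEStronglyMeasurable (fun w => ‖h w‖ ^ 2) (volume.restrict D) :=
    (hh.continuousOn.norm.pow 2).aestronglyMeasurable hD.measurableSet
  have hi : IntegrableOn (fun w => ‖h w‖ ^ 2) D := by
    refine ⟨hm, ?_⟩
    rw [hasFiniteIntegral_iff_enorm]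
    refine lt_of_le_of_lt (le_of_eq (lintegral_congr fun w => ?_))
      (hle.trans_lt ENNReal.ofReal_lt_top)
    rw [enorm_pow, enorm_norm]
  refine ⟨hi, ?_⟩
  rwa [lintegral_enorm_sq_eq hi, ENNReal.ofReal_le_ofReal_iff hC] at hle

lemma enorm_sq_mul_volume_le (hD : IsOpen D) {h : Cn n → ℂ} (hh : DifferentiableOn ℂ h D)
    {S : Set (Cn n)} (hS : MeasurableSet S) (hrot : ∀ c : ℂ, ‖c‖ = 1 → ∀ w ∈ S, c • w ∈ S)
    {p : Cn n} (hmem : ∀ w ∈ S, ∀ t : ℂ, ‖t‖ ≤ 1 → p + t • w ∈ D) :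
    ‖h p‖ₑ ^ 2 * volume S ≤ ∫⁻ w in D, ‖h w‖ₑ ^ 2 := by
  have hpS : ∀ w ∈ S, p + w ∈ D := fun w hw => by
    simpa using hmem w hw 1 (by simp)
  have h1 : ∫⁻ _ in S, ‖h p‖ₑ ^ 2 ≤ ∫⁻ w in S, ‖h (p + w)‖ₑ ^ 2 := by
    refine setLIntegral_le_of_circle_mean (fun c hc => measurePreserving_smul_Cn hc) hS hrot
      (m := fun _ => ‖h p‖ₑ ^ 2) ?_ ?_
    · have : ContinuousOn (fun w => h (p + w)) S :=
        hh.continuousOn.comp (f := fun w => p + w) (by fun_prop) fun w hw => hpS w hw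
      exact (ENNReal.continuous_pow 2).comp_continuousOn this.enorm
    · intro w hw
      have hF : DiffContOnCl ℂ (fun t : ℂ => h (p + t • w) ^ 2) (ball 0 1) := by
        apply DifferentiableOn.diffContOnCl
        rw [closure_ball _ one_ne_zero]
        intro t ht
        refine (DifferentiableAt.fun_pow (DifferentiableAt.comp t (f := fun t : ℂ => p + t • w)
          (hh.differentiableAt (hD.mem_nhds (hmem w hw t (by simpa using ht)))) ?_)
          2).differentiableWithinAt
        fun_prop
      simpa [enorm_pow] using enorm_mul_le_lintegral_circle hF
  rw [setLIntegral_const] at h1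
  refine h1.trans ?_
  rw [(measurePreserving_add_left volume p).setLIntegral_comp_emb
    (measurableEmbedding_addLeft p) (fun w => ‖h w‖ₑ ^ 2)]
  refine lintegral_mono_set ?_
  rintro _ ⟨w, hw, rfl⟩
  exact hpS w hw

variable {L : Cn n ≃L[ℂ] (Fin n → ℂ)} {κ : NNReal}

lemma IsUnivalent.lintegral_enorm_deriv_sq_le {G : Set ℂ} {f : ℂ → ℂ} (hf : IsUnivalent G f)
    (hG : IsOpen G) : ∫⁻ t in G, ‖deriv f t‖ₑ ^ 2 ≤ ENNReal.ofReal Real.pi := by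
  have h := setLIntegral_image_holomorphic hG hG.measurableSet Subset.rfl hf.diff hf.inj 1
  simp only [Pi.one_apply, mul_one, setLIntegral_one] at h
  calc ∫⁻ t in G, ‖deriv f t‖ₑ ^ 2 = volume (f '' G) := by
        rw [h]
        refine lintegral_congr fun t => ?_
        rw [ENNReal.ofReal_pow (norm_nonneg _), ofReal_norm]
    _ ≤ volume (ball (0 : ℂ) 1) := measure_mono hf.maps.image_subset
    _ = ENNReal.ofReal Real.pi := by
        rw [Complex.volume_ball, ← NNReal.coe_real_pi, ENNReal.ofReal_coe_nnreal]
        simp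

namespace IsFrame

lemma exists_isUnivalent (hL : IsFrame D z L) (h : LineConvex D) (hD : IsOpen D) (hz : z ∈ D)
    (j : Fin n) : ∃ (G : Set ℂ) (f : ℂ → ℂ), IsOpen G ∧ IsUnivalent G f ∧
      1 / 8 ≤ ‖deriv f 1‖ ∧ ∀ w ∈ D, 1 - L (w - z) j ∈ G := by
  obtain ⟨G, f, hG, hf, -, hη, -, hmem⟩ := h.exists_isUnivalent hD hz
    (l := (LinearMap.proj j).comp (L : Cn n →ₗ[ℂ] (Fin n → ℂ))) (v := L.symm (Pi.single j 1))
    (by simp) (fun w hw => by simpa using hL.ne_one j w hw) (η := 1 / 8) (by norm_num)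
  exact ⟨G, f, hG, hf, hη, fun w hw => by simpa using hmem w hw⟩

/-- A holomorphic function with controlled `L²` norm which is not small at `z`. -/
lemma exists_lintegral_enorm_sq_le (hL : IsFrame D z L) (h : LineConvex D) (hD : IsOpen D)
    (hz : z ∈ D) (hκ : Measure.map L volume = κ • (volume : Measure (Fin n → ℂ))) :
    ∃ f : Cn n → ℂ, DifferentiableOn ℂ f D ∧ (1 / 8) ^ n ≤ ‖f z‖ ∧
      ∫⁻ w in D, ‖f w‖ₑ ^ 2 ≤ ENNReal.ofReal (κ * Real.pi ^ n) := by
  choose G f hG hf hη hmem using hL.exists_isUnivalent h hD hz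
  have hd : ∀ j, DifferentiableOn ℂ (deriv (f j)) (G j) := fun j => (hf j).diff.deriv (hG j)
  refine ⟨fun w => ∏ j, deriv (f j) (1 - L (w - z) j), ?_, ?_, ?_⟩
  · have hF : ∀ j, DifferentiableOn ℂ (fun w => deriv (f j) (1 - L (w - z) j)) D := fun j =>
      (hd j).comp (f := fun w => 1 - L (w - z) j) (by fun_prop) fun w hw => hmem j w hw
    intro w hw
    classical
    exact (HasFDerivWithinAt.finsetProd fun j _ =>
      (hF j w hw).hasFDerivWithinAt).differentiableWithinAt
  · rw [norm_prod]
    calc ((1 : ℝ) / 8) ^ n = ∏ _j : Fin n, (1 / 8 : ℝ) := by simp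
      _ ≤ _ := by
        refine Finset.prod_le_prod (fun _ _ => by norm_num) fun j _ => ?_
        simpa using hη j
  · set Φ : Fin n → ℂ → ENNReal := fun j => (G j).indicator fun t => ‖deriv (f j) t‖ₑ ^ 2 with hΦ
    have hΦm : ∀ j, Measurable (Φ j) := fun j =>
      ((measurable_deriv (f j)).enorm.pow_const 2).indicator (hG j).measurableSet
    have hΦ1 : ∀ j, Measurable fun t => Φ j (1 - t) := fun j =>
      (hΦm j).comp (measurable_const.sub measurable_id)
    have hmeas : Measurable fun v : Fin n → ℂ => ∏ j, Φ j (1 - v j) :=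
      Finset.measurable_prod _ fun j _ => (hΦ1 j).comp (measurable_pi_apply j)
    calc ∫⁻ w in D, ‖∏ j, deriv (f j) (1 - L (w - z) j)‖ₑ ^ 2
        = ∫⁻ w in D, ∏ j, Φ j (1 - L (w - z) j) := by
          refine setLIntegral_congr_fun hD.measurableSet fun w hw => ?_
          simp only [hΦ, indicator_of_mem (hmem _ w hw), Finset.prod_pow]
          rw [← ofReal_norm, norm_prod, ENNReal.ofReal_prod_of_nonneg fun _ _ => norm_nonneg _]
          simp only [ofReal_norm]
      _ ≤ ∫⁻ w, ∏ j, Φ j (1 - L (w - z) j) := setLIntegral_le_lintegral _ _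
      _ = ∫⁻ w, ∏ j, Φ j (1 - L w j) :=
          lintegral_sub_right_eq_self (fun w => ∏ j, Φ j (1 - L w j)) z
      _ = κ * ∫⁻ v : Fin n → ℂ, ∏ j, Φ j (1 - v j) := by
          rw [← lintegral_map hmeas L.continuous.measurable, hκ, lintegral_smul_measure]
          rfl
      _ = κ * ∏ j, ∫⁻ t, Φ j t := by
          rw [lintegral_fin_prod_eq_prod hΦ1]
          simp_rw [lintegral_sub_left_eq_self]
      _ ≤ κ * ∏ _j : Fin n, ENNReal.ofReal Real.pi := by
          gcongr with j
          rw [hΦ, lintegral_indicator (hG j).measurableSet]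
          exact (hf j).lintegral_enorm_deriv_sq_le (hG j)
      _ = ENNReal.ofReal (κ * Real.pi ^ n) := by
          rw [ENNReal.ofReal_mul κ.coe_nonneg, ENNReal.ofReal_pow Real.pi_pos.le,
            ENNReal.ofReal_coe_nnreal]
          simp

lemma norm_sq_mul_le_integral (hL : IsFrame D z L) (hD : IsOpen D) (hn : 0 < n)
    (hκ : Measure.map L volume = κ • (volume : Measure (Fin n → ℂ)))
    {h : Cn n → ℂ} (hh : DifferentiableOn ℂ h D) (hi : IntegrableOn (fun w => ‖h w‖ ^ 2) D)
    {q : Cn n} (hq : ‖L q‖ ≤ 1 / (2 * n)) :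
    ‖h (z + q)‖ ^ 2 * (κ * Real.pi ^ n * (1 / (2 * n)) ^ (2 * n)) ≤ ∫ w in D, ‖h w‖ ^ 2 := by
  have hn' : (0 : ℝ) < n := Nat.cast_pos.2 hn
  have hρ : (0 : ℝ) < 1 / (2 * n) := by positivity
  have hopen : IsOpen {w : Cn n | ‖L w‖ < 1 / (2 * n)} :=
    isOpen_lt (by fun_prop) continuous_const
  have key := enorm_sq_mul_volume_le hD hh hopen.measurableSet (p := z + q)
    (fun c hc w hw => by simpa [norm_smul, hc] using hw) (fun w hw t ht => by
      rw [add_assoc]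
      refine hL.mem _ ?_
      rw [mem_ofPred_eq] at hw
      have h1 : ∀ j, ‖L (q + t • w) j‖ ≤ 1 / (2 * n) + ‖L w‖ := by
        intro j
        rw [map_add, map_smul]
        refine (norm_add_le _ _).trans (add_le_add ((norm_le_pi_norm _ j).trans hq) ?_)
        rw [Pi.smul_apply, norm_smul]
        exact (mul_le_of_le_one_left (norm_nonneg _) ht).trans (norm_le_pi_norm _ j)
      calc ∑ j, ‖L (q + t • w) j‖ ≤ ∑ _j : Fin n, (1 / (2 * n) + ‖L w‖) :=
            Finset.sum_le_sum fun j _ => h1 j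
        _ = n * (1 / (2 * n) + ‖L w‖) := by
          rw [Finset.sum_const, Finset.card_univ, Fintype.card_fin, nsmul_eq_mul]
        _ < n * (1 / (2 * n) + 1 / (2 * n)) := by gcongr
        _ = 1 := by field_simp; norm_num)
  rw [volume_preimage_ball hκ hρ, lintegral_enorm_sq_eq hi, ← ofReal_norm,
    ← ENNReal.ofReal_pow (norm_nonneg _), ← ENNReal.ofReal_mul (by positivity)] at key
  exact (ENNReal.ofReal_le_ofReal_iff (integral_nonneg fun w => by positivity)).1 key

lemma norm_fderiv_le_sqrt_integral (hL : IsFrame D z L) (hD : IsOpen D) (hn : 0 < n) (hκ0 : 0 < κ)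
    (hκ : Measure.map L volume = κ • (volume : Measure (Fin n → ℂ)))
    {h : Cn n → ℂ} (hh : DifferentiableOn ℂ h D) (hi : IntegrableOn (fun w => ‖h w‖ ^ 2) D)
    {X : Cn n} (hX : X ≠ 0) :
    ‖fderiv ℂ h z X‖ ≤ √((∫ w in D, ‖h w‖ ^ 2) / (κ * Real.pi ^ n)) *
      (2 * n) ^ (n + 1) * ‖L X‖ := by
  have hn' : (0 : ℝ) < n := Nat.cast_pos.2 hn
  have hLX : 0 < ‖L X‖ := by simpa using hX
  have hW : 0 < κ * Real.pi ^ n := by positivity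
  have hbound : ∀ s : ℂ, ‖s‖ ≤ 1 / (2 * n) / ‖L X‖ → ‖L (s • X)‖ ≤ 1 / (2 * n) := by
    intro s hs
    rw [map_smul, norm_smul]
    rwa [le_div_iff₀ hLX] at hs
  have key := norm_fderiv_le_of_forall_disc hD hh (z := z) (X := X)
    (R := 1 / (2 * n) / ‖L X‖) (by positivity)
    (C := √((∫ w in D, ‖h w‖ ^ 2) / (κ * Real.pi ^ n)) * (2 * n) ^ n) (fun s hs => ?_)
    (fun s hs => ?_)
  · refine key.trans (le_of_eq ?_)
    rw [pow_succ]
    field_simp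
  · refine hL.mem _ (lt_of_le_of_lt (Finset.sum_le_sum fun j _ =>
      (norm_le_pi_norm _ j).trans (hbound s hs)) ?_)
    simp only [Finset.sum_const, Finset.card_univ, Fintype.card_fin, nsmul_eq_mul]
    field_simp
    norm_num
  · have := hL.norm_sq_mul_le_integral hD hn hκ hh hi (hbound s hs)
    rw [← Real.sqrt_sq (by positivity : (0 : ℝ) ≤ (2 * n) ^ n), ← Real.sqrt_mul' _ (by positivity)]
    refine Real.le_sqrt_of_sq_le ?_
    rw [div_mul_eq_mul_div, le_div_iff₀ hW, ← pow_mul, mul_comm n 2]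
    calc ‖h (z + s • X)‖ ^ 2 * (κ * Real.pi ^ n)
        = ‖h (z + s • X)‖ ^ 2 * (κ * Real.pi ^ n * (1 / (2 * n)) ^ (2 * n)) *
          (2 * n) ^ (2 * n) := by
          rw [one_div, inv_pow]
          field_simp
      _ ≤ _ := by gcongr

end IsFrame

lemma caraMetric_nonneg (D : Set (Cn n)) (z X : Cn n) : 0 ≤ caraMetric D z X :=
  Real.sSup_nonneg (by rintro _ ⟨f, -, -, -, rfl⟩; exact norm_nonneg _)

lemma bergmanM_nonneg (D : Set (Cn n)) (z X : Cn n) : 0 ≤ bergmanM D z X :=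
  Real.sSup_nonneg (by rintro _ ⟨f, -, -, -, -, rfl⟩; exact norm_nonneg _)

namespace IsFrame

lemma norm_le_four_mul_caraMetric (hL : IsFrame D z L) (h : LineConvex D) (hD : IsOpen D)
    (hz : z ∈ D) (X : Cn n) : ‖L X‖ ≤ 4 * caraMetric D z X := by
  rw [pi_norm_le_iff_of_nonneg (mul_nonneg zero_le_four (caraMetric_nonneg D z X))]
  intro j
  have := norm_div_four_le_caraMetric h hD hz
    (l := (LinearMap.proj j).comp (L : Cn n →ₗ[ℂ] (Fin n → ℂ))) (v := L.symm (Pi.single j 1))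
    (by simp) (fun w hw => by simpa using hL.ne_one j w hw) X
  have h2 : ‖L X j‖ / 4 ≤ caraMetric D z X := this
  linarith

lemma le_bergmanKernel (hL : IsFrame D z L) (hD : IsOpen D) (hn : 0 < n) (hκ0 : 0 < κ)
    (hκ : Measure.map L volume = κ • (volume : Measure (Fin n → ℂ)))
    {f : Cn n → ℂ} (hf : DifferentiableOn ℂ f D)
    (hi : IntegrableOn (fun w => ‖f w‖ ^ 2) D) (h1 : ∫ w in D, ‖f w‖ ^ 2 ≤ 1) :
    ‖f z‖ ^ 2 ≤ bergmanKernel D z := by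
  have hn' : (0 : ℝ) < n := Nat.cast_pos.2 hn
  refine le_csSup ⟨1 / (κ * Real.pi ^ n * (1 / (2 * n)) ^ (2 * n)), ?_⟩ ⟨f, hf, hi, h1, rfl⟩
  rintro _ ⟨g, hg, hgi, hg1, rfl⟩
  rw [le_div_iff₀ (by positivity)]
  have := hL.norm_sq_mul_le_integral hD hn hκ hg hgi (q := 0) (by rw [map_zero, norm_zero]; positivity)
  rw [add_zero] at this
  exact this.trans hg1

lemma div_le_bergmanKernel (hL : IsFrame D z L) (h : LineConvex D) (hD : IsOpen D) (hz : z ∈ D)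
    (hn : 0 < n) (hκ0 : 0 < κ)
    (hκ : Measure.map L volume = κ • (volume : Measure (Fin n → ℂ))) :
    ((1 / 8) ^ n) ^ 2 / (κ * Real.pi ^ n) ≤ bergmanKernel D z := by
  have hW : 0 < κ * Real.pi ^ n := by positivity
  obtain ⟨f, hf, hfz, hfle⟩ := hL.exists_lintegral_enorm_sq_le h hD hz hκ
  obtain ⟨hi, hle⟩ := integrableOn_norm_sq_of_lintegral_le hD hf hW.le hfle
  set a : ℝ := (√(κ * Real.pi ^ n))⁻¹ with ha
  have ha2 : a ^ 2 = (κ * Real.pi ^ n)⁻¹ := by rw [ha, inv_pow, Real.sq_sqrt hW.le]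
  have hnorm : ∀ w, ‖(a : ℂ) * f w‖ ^ 2 = (κ * Real.pi ^ n)⁻¹ * ‖f w‖ ^ 2 := fun w => by
    rw [norm_mul, norm_real, mul_pow, Real.norm_eq_abs, sq_abs, ha2]
  have := hL.le_bergmanKernel hD hn hκ0 hκ (f := fun w => a * f w) (hf.const_mul _)
    (by simp only [hnorm]; exact hi.const_mul _)
    (by
      simp only [hnorm]
      rw [integral_const_mul, inv_mul_le_iff₀ hW, mul_one]
      exact hle)
  refine le_trans ?_ this
  rw [hnorm, div_eq_inv_mul]
  gcongr

lemma le_bergmanM (hL : IsFrame D z L) (hD : IsOpen D) (hn : 0 < n) (hκ0 : 0 < κ)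
    (hκ : Measure.map L volume = κ • (volume : Measure (Fin n → ℂ)))
    {X : Cn n} (hX : X ≠ 0) {f : Cn n → ℂ} (hf : DifferentiableOn ℂ f D)
    (hi : IntegrableOn (fun w => ‖f w‖ ^ 2) D) (h1 : ∫ w in D, ‖f w‖ ^ 2 = 1) (hfz : f z = 0) :
    ‖fderiv ℂ f z X‖ ≤ bergmanM D z X := by
  refine le_csSup ⟨√(1 / (κ * Real.pi ^ n)) * (2 * n) ^ (n + 1) * ‖L X‖, ?_⟩
    ⟨f, hf, hi, h1, hfz, rfl⟩
  rintro _ ⟨g, hg, hgi, hg1, -, rfl⟩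
  rw [← hg1]
  exact hL.norm_fderiv_le_sqrt_integral hD hn hκ0 hκ hg hgi hX

lemma bergmanM_le (hL : IsFrame D z L) (hD : IsOpen D) (hn : 0 < n) (hκ0 : 0 < κ)
    (hκ : Measure.map L volume = κ • (volume : Measure (Fin n → ℂ)))
    {X : Cn n} (hX : X ≠ 0) :
    bergmanM D z X ≤ √(1 / (κ * Real.pi ^ n)) * (2 * n) ^ (n + 1) * ‖L X‖ := by
  refine Real.sSup_le ?_ (by positivity)
  rintro _ ⟨g, hg, hgi, hg1, -, rfl⟩
  rw [← hg1]
  exact hL.norm_fderiv_le_sqrt_integral hD hn hκ0 hκ hg hgi hX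

lemma bergmanMetric_le (hL : IsFrame D z L) (h : LineConvex D) (hD : IsOpen D) (hz : z ∈ D)
    (hn : 0 < n) (hκ0 : 0 < κ)
    (hκ : Measure.map L volume = κ • (volume : Measure (Fin n → ℂ))) {X : Cn n} (hX : X ≠ 0) :
    bergmanMetric D z X ≤ 4 * (8 ^ n * (2 * n) ^ (n + 1)) * caraMetric D z X := by
  have hn' : (0 : ℝ) < n := Nat.cast_pos.2 hn
  have hW : 0 < κ * Real.pi ^ n := by positivity
  have hK : √(1 / (κ * Real.pi ^ n)) * (1 / 8) ^ n ≤ √(bergmanKernel D z) := by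
    rw [← Real.sqrt_sq (by positivity : (0 : ℝ) ≤ (1 / 8) ^ n), ← Real.sqrt_mul' _ (by positivity)]
    refine Real.sqrt_le_sqrt (le_trans (le_of_eq ?_) (hL.div_le_bergmanKernel h hD hz hn hκ0 hκ))
    ring
  have hs : 0 < √(1 / (κ * Real.pi ^ n)) := Real.sqrt_pos.2 (by positivity)
  have hKpos : 0 < √(bergmanKernel D z) := lt_of_lt_of_le (by positivity) hK
  have h8 : ((1 : ℝ) / 8) ^ n * 8 ^ n = 1 := by rw [← mul_pow]; norm_num
  rw [bergmanMetric, div_le_iff₀ hKpos]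
  calc bergmanM D z X ≤ √(1 / (κ * Real.pi ^ n)) * (2 * n) ^ (n + 1) * ‖L X‖ :=
        hL.bergmanM_le hD hn hκ0 hκ hX
    _ ≤ √(1 / (κ * Real.pi ^ n)) * (2 * n) ^ (n + 1) * (4 * caraMetric D z X) := by
        gcongr
        exact hL.norm_le_four_mul_caraMetric h hD hz X
    _ = 4 * (8 ^ n * (2 * n) ^ (n + 1)) * caraMetric D z X *
        (√(1 / (κ * Real.pi ^ n)) * (1 / 8) ^ n) := by
        linear_combination (-(√(1 / (κ * Real.pi ^ n)) * (2 * n) ^ (n + 1) *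
          (4 * caraMetric D z X))) * h8
    _ ≤ _ := by
        have := caraMetric_nonneg D z X
        gcongr

lemma norm_fderiv_mul_norm_le_bergmanM (hL : IsFrame D z L) (hD : IsOpen D) (hz : z ∈ D)
    (hn : 0 < n) (hκ0 : 0 < κ)
    (hκ : Measure.map L volume = κ • (volume : Measure (Fin n → ℂ))) {X : Cn n} (hX : X ≠ 0)
    {f g : Cn n → ℂ} (hf : DifferentiableOn ℂ f D) (hfD : MapsTo f D (ball (0 : ℂ) 1))
    (hfz : f z = 0) (hg : DifferentiableOn ℂ g D)
    (hgi : IntegrableOn (fun w => ‖g w‖ ^ 2) D) (hg1 : ∫ w in D, ‖g w‖ ^ 2 ≤ 1) :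
    ‖fderiv ℂ f z X‖ * ‖g z‖ ≤ bergmanM D z X := by
  have hd : DifferentiableOn ℂ (fun w => f w * g w) D := hf.fun_mul hg
  have hle : ∀ w ∈ D, ‖f w * g w‖ ^ 2 ≤ ‖g w‖ ^ 2 := fun w hw => by
    have h1 := mem_ball_zero_iff.1 (hfD hw)
    rw [norm_mul]
    gcongr
    exact mul_le_of_le_one_left (norm_nonneg _) h1.le
  have hi : IntegrableOn (fun w => ‖f w * g w‖ ^ 2) D := by
    refine hgi.mono' ((hd.continuousOn.norm.pow 2).aestronglyMeasurable hD.measurableSet) ?_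
    filter_upwards [ae_restrict_mem hD.measurableSet] with w hw
    rw [Real.norm_of_nonneg (by positivity)]
    exact hle w hw
  have hder : ‖fderiv ℂ (fun w => f w * g w) z X‖ = ‖fderiv ℂ f z X‖ * ‖g z‖ := by
    rw [fderiv_fun_mul (hf.differentiableAt (hD.mem_nhds hz))
      (hg.differentiableAt (hD.mem_nhds hz)), hfz]
    simp [mul_comm]
  rw [← hder]
  set ν : ℝ := ∫ w in D, ‖f w * g w‖ ^ 2 with hν
  have hν0 : 0 ≤ ν := integral_nonneg fun w => by positivity
  have hν1 : ν ≤ 1 := (setIntegral_mono_on hi hgi hD.measurableSet hle).trans hg1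
  rcases hν0.eq_or_lt with h0 | hpos
  · have := hL.norm_fderiv_le_sqrt_integral hD hn hκ0 hκ hd hi hX
    rw [← hν, ← h0, zero_div, Real.sqrt_zero, zero_mul, zero_mul] at this
    exact this.trans (bergmanM_nonneg D z X)
  · have hs : 0 < √ν := Real.sqrt_pos.2 hpos
    set a : ℝ := (√ν)⁻¹ with ha
    have ha0 : 0 < a := inv_pos.2 hs
    have ha2 : a ^ 2 = ν⁻¹ := by rw [ha, inv_pow, Real.sq_sqrt hpos.le]
    have hnorm : ∀ w, ‖(a : ℂ) * (f w * g w)‖ ^ 2 = ν⁻¹ * ‖f w * g w‖ ^ 2 := fun w => by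
      rw [norm_mul, norm_real, mul_pow, Real.norm_eq_abs, sq_abs, ha2]
    have := hL.le_bergmanM hD hn hκ0 hκ hX (f := fun w => a * (f w * g w)) (hd.const_mul _)
      (by simp only [hnorm]; exact hi.const_mul _)
      (by simp only [hnorm]; rw [integral_const_mul, inv_mul_cancel₀ hpos.ne'])
      (by rw [hfz]; ring)
    rw [fderiv_const_mul (hd.differentiableAt (hD.mem_nhds hz)), _root_.smul_apply, norm_smul,
      norm_real, Real.norm_of_nonneg ha0.le] at this
    refine le_trans (le_mul_of_one_le_left (norm_nonneg _) ?_) this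
    rw [ha]
    exact (one_le_inv₀ hs).2 (Real.sqrt_le_one.2 hν1)

lemma caraMetric_le_bergmanMetric (hL : IsFrame D z L) (h : LineConvex D) (hD : IsOpen D)
    (hz : z ∈ D) (hn : 0 < n) (hκ0 : 0 < κ)
    (hκ : Measure.map L volume = κ • (volume : Measure (Fin n → ℂ))) {X : Cn n} (hX : X ≠ 0) :
    caraMetric D z X ≤ bergmanMetric D z X := by
  have hKpos : 0 < bergmanKernel D z :=
    lt_of_lt_of_le (by positivity) (hL.div_le_bergmanKernel h hD hz hn hκ0 hκ)
  have hM := bergmanM_nonneg D z X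
  refine Real.sSup_le ?_ (div_nonneg hM (Real.sqrt_nonneg _))
  rintro _ ⟨f, hf, hfD, hfz, rfl⟩
  rw [bergmanMetric, le_div_iff₀ (Real.sqrt_pos.2 hKpos)]
  rcases (norm_nonneg (fderiv ℂ f z X)).eq_or_lt with h0 | hpos
  · rwa [← h0, zero_mul]
  rw [← le_div_iff₀' hpos]
  refine Real.sqrt_le_iff.2 ⟨by positivity, Real.sSup_le ?_ (by positivity)⟩
  rintro _ ⟨g, hg, hgi, hg1, rfl⟩
  gcongr
  rw [le_div_iff₀' hpos]
  exact hL.norm_fderiv_mul_norm_le_bergmanM hD hz hn hκ0 hκ hX hf hfD hfz hg hgi hg1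

end IsFrame

end BergmanEstimates

/-- There is `c_n > 0` such that for every ℂ-convex domain
`D ⊆ ℂⁿ` containing no complex line, `κ_D/4 ≤ B_D ≤ 4c_n·γ_D`. -/
theorem statement12 (n : ℕ) :
    ∃ c : ℝ, 0 < c ∧ ∀ D : Set (Cn n), IsDomain' D → IsCConvex D → NoComplexLine D →
      ∀ z ∈ D, ∀ X : Cn n, X ≠ 0 →
        kobMetric D z X / 4 ≤ bergmanMetric D z X ∧
        bergmanMetric D z X ≤ 4 * c * caraMetric D z X := by
  rcases n.eq_zero_or_pos with rfl | hn
  · exact ⟨1, one_pos, fun D _ _ _ z _ X hX => absurd (Subsingleton.elim X 0) hX⟩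
  have hn' : (0 : ℝ) < n := Nat.cast_pos.2 hn
  refine ⟨8 ^ n * (2 * n) ^ (n + 1), by positivity, fun D hdom hconv hno z hz X hX => ?_⟩
  have hD := hdom.1
  have h := hconv.lineConvex hD
  obtain ⟨L, hL⟩ := h.exists_isFrame hD hno hz
  obtain ⟨κ, hκ0, hκ⟩ := exists_map_volume_eq_smul L
  refine ⟨?_, hL.bergmanMetric_le h hD hz hn hκ0 hκ hX⟩
  have h1 := hL.caraMetric_le_bergmanMetric h hD hz hn hκ0 hκ hX
  have h2 := kobMetric_le_four_mul_caraMetric h hD hno hz hX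
  linarith

end
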